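/- arXiv:1906.00344 — 6 statements merged into one kernel-verified Lean document; each statement's English description precedes it below -/
import Mathlib

section
/- Let r ≥ 0 be an integer, ω = (ω_1,…,ω_r) a tuple of complex numbers with Re ω_j > 0 for all j, w ∈ ℂ with Re w > 0, and s ∈ ℂ with Re s > r. Then the family ((n_1ω_1 + ⋯ + n_rω_r + w)^{−s})_{(n_1,…,n_r) ∈ (ℤ_{≥0})^r} is summable; in particular the multiple series ∑_{n ∈ (ℤ_{≥0})^r} (n·ω + w)^{−s} converges absolutely. -/
/-- A product of summable nonnegative functions of separate variables is summable. -/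
theorem summable_pi_prod_of_nonneg {α : Type*} {r : ℕ} {f : Fin r → α → ℝ}
    (hf : ∀ i a, 0 ≤ f i a) (hs : ∀ i, Summable (f i)) :
    Summable fun n : Fin r → α => ∏ i, f i (n i) := by
  induction r with
  | zero => exact Summable.of_finite
  | succ r ih =>
    rw [← (Fin.consEquiv fun _ => α).summable_iff]
    have h := (hs 0).mul_of_nonneg (ih (fun i => hf i.succ) fun i => hs i.succ) (hf 0)
      fun n => Finset.prod_nonneg fun i _ => hf i.succ (n i)
    refine h.congr fun p => ?_
    simp [Fin.prod_univ_succ, Fin.consEquiv]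

/-- For `c > 0` and `p > 1`, the series `∑ (c (n + 1)) ^ (-p)` converges. -/
theorem summable_const_mul_nat_succ_rpow_neg {c p : ℝ} (hc : 0 < c) (hp : 1 < p) :
    Summable fun n : ℕ => (c * (n + 1)) ^ (-p) := by
  have h := (((summable_nat_add_iff 1).2 (Real.summable_nat_rpow.2 (neg_lt_neg hp))).mul_left
    (c ^ (-p)))
  refine h.congr fun n => ?_
  rw [Real.mul_rpow hc.le (by positivity)]
  push_cast
  rfl

/-- If `x` dominates each of `r > 0` positive numbers `y i`, then `x ^ (-p)` is at most the
product of the `y i ^ (-(p / r))`. -/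
theorem rpow_neg_le_prod_rpow_neg_div {r : ℕ} (hr : 0 < r) {x p : ℝ} (hx : 0 < x) (hp : 0 ≤ p)
    {y : Fin r → ℝ} (hy : ∀ i, 0 < y i) (hyx : ∀ i, y i ≤ x) :
    x ^ (-p) ≤ ∏ i, y i ^ (-(p / r)) := by
  have hr' : (r : ℝ) ≠ 0 := by positivity
  calc x ^ (-p) = ∏ _i : Fin r, x ^ (-(p / r)) := by
        rw [Finset.prod_const, Finset.card_univ, Fintype.card_fin, ← Real.rpow_mul_natCast hx.le]
        congr 1
        field_simp
    _ ≤ ∏ i, y i ^ (-(p / r)) := Finset.prod_le_prod (fun _ _ => by positivity) fun i _ =>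
        Real.rpow_le_rpow_of_nonpos (hy i) (hyx i) (neg_nonpos.2 (by positivity))

/-- The norm of `z ^ (-s)` is bounded by `‖z‖ ^ (-s.re)`, up to a factor independent of `z`. -/
theorem norm_cpow_neg_le_rpow_mul_exp (z s : ℂ) :
    ‖z ^ (-s)‖ ≤ ‖z‖ ^ (-s.re) * Real.exp (Real.pi * |s.im|) := by
  refine (Complex.norm_cpow_le z (-s)).trans ?_
  rw [Complex.neg_re, Complex.neg_im, div_eq_mul_inv, ← Real.exp_neg]
  gcongr
  calc -(z.arg * -s.im) ≤ |z.arg * s.im| := by simpa using le_abs_self (z.arg * s.im)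
    _ = |z.arg| * |s.im| := abs_mul _ _
    _ ≤ Real.pi * |s.im| := by gcongr; exact Complex.abs_arg_le_pi z

/-- Each coordinate of `n` bounds the real part of `n·ω + w` from below. -/
theorem min_mul_succ_le_re_sum {r : ℕ} {ω : Fin r → ℂ} (hω : ∀ j, 0 < (ω j).re) (w : ℂ)
    (n : Fin r → ℕ) (i : Fin r) :
    min (ω i).re w.re * (n i + 1) ≤ (∑ j, (n j : ℂ) * ω j + w).re := by
  have hle : (n i : ℝ) * (ω i).re ≤ ∑ j, (n j : ℝ) * (ω j).re :=
    Finset.single_le_sum (f := fun j => (n j : ℝ) * (ω j).re)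
      (fun j _ => mul_nonneg (Nat.cast_nonneg _) (hω j).le) (Finset.mem_univ i)
  have hmul : min (ω i).re w.re * n i ≤ (n i : ℝ) * (ω i).re := by
    rw [mul_comm]
    gcongr
    exact min_le_left _ _
  have hre : (∑ j, (n j : ℂ) * ω j + w).re = ∑ j, (n j : ℝ) * (ω j).re + w.re := by
    simp
  rw [hre, mul_add, mul_one]
  exact add_le_add (hmul.trans hle) (min_le_right _ _)

/-- For `r ≥ 0`, `ω` a tuple of complex numbers with positive real
parts, `Re w > 0` and `Re s > r`, the family `((n·ω + w)^{-s})_{n ∈ ℕ^r}` is summable;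
in particular the multiple series converges absolutely. -/
theorem multiple_hurwitz_zeta_summable (r : ℕ) (ω : Fin r → ℂ)
    (hω : ∀ j, 0 < (ω j).re) (w : ℂ) (hw : 0 < w.re) (s : ℂ) (hs : (r : ℝ) < s.re) :
    Summable (fun n : Fin r → ℕ => (∑ i, (n i : ℂ) * ω i + w) ^ (-s)) ∧
    Summable (fun n : Fin r → ℕ => ‖(∑ i, (n i : ℂ) * ω i + w) ^ (-s)‖) := by
  suffices h : Summable (fun n : Fin r → ℕ => ‖(∑ i, (n i : ℂ) * ω i + w) ^ (-s)‖) from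
    ⟨h.of_norm, h⟩
  rcases r.eq_zero_or_pos with rfl | hr
  · exact Summable.of_finite
  have hr' : (0 : ℝ) < r := Nat.cast_pos.2 hr
  have hc : ∀ i, 0 < min (ω i).re w.re := fun i => lt_min (hω i) hw
  have hsum := (summable_pi_prod_of_nonneg
    (f := fun i (k : ℕ) => (min (ω i).re w.re * (k + 1)) ^ (-(s.re / r)))
    (fun i k => Real.rpow_nonneg (mul_nonneg (hc i).le (by positivity)) _)
    fun i => summable_const_mul_nat_succ_rpow_neg (hc i) ((one_lt_div hr').2 hs)).mul_right
      (Real.exp (Real.pi * |s.im|))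
  refine hsum.of_nonneg_of_le (fun _ => norm_nonneg _) fun n => ?_
  refine (norm_cpow_neg_le_rpow_mul_exp _ s).trans ?_
  have hy : ∀ i, 0 < min (ω i).re w.re * ((n i : ℝ) + 1) := fun i =>
    mul_pos (hc i) (by positivity)
  have hyx : ∀ i, min (ω i).re w.re * ((n i : ℝ) + 1) ≤ ‖∑ j, (n j : ℂ) * ω j + w‖ := fun i =>
    (min_mul_succ_le_re_sum hω w n i).trans (Complex.re_le_norm _)
  exact mul_le_mul_of_nonneg_right (rpow_neg_le_prod_rpow_neg_div hr
    ((hy ⟨0, hr⟩).trans_le (hyx ⟨0, hr⟩)) (hr'.trans hs).le hy hyx) (Real.exp_nonneg _)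
end

section
/- Let r ≥ 0 be an integer, ω = (ω_1,…,ω_r) a tuple of complex numbers with Re ω_j > 0 for all j, w ∈ ℂ with Re w > 0, and s ∈ ℂ with Re s > r. Then the integral ∫_0^∞ f_ω(t) e^{−wt} t^{s−1} dt converges absolutely and Γ(s) · ζ_r(s,w;ω) = ∫_0^∞ f_ω(t) e^{−wt} t^{s−1} dt, where for real t > 0 one sets t^{s−1} = exp((s−1)·log t) and Γ is the complex Gamma function. -/
open MeasureTheory

/-- `fprod r ω t = ∏_{j=1}^r (1 - exp(-ω_j t))⁻¹` (empty product = 1). -/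
noncomputable def fprod (r : ℕ) (ω : Fin r → ℂ) (t : ℂ) : ℂ :=
  ∏ j, (1 - Complex.exp (-(ω j) * t))⁻¹

/-- Distributivity of finite products over absolutely convergent series, together with absolute
convergence of the multiple series. -/
theorem summable_norm_and_hasSum_fin_prod {R : Type*} [NormedField R] [CompleteSpace R] (r : ℕ)
    (f : Fin r → ℕ → R) (hf : ∀ i, Summable fun k => ‖f i k‖) :
    (Summable fun n : Fin r → ℕ => ‖∏ i, f i (n i)‖) ∧
      HasSum (fun n : Fin r → ℕ => ∏ i, f i (n i)) (∏ i, ∑' k, f i k) := by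
  induction r with
  | zero =>
    refine ⟨(hasSum_fintype _).summable, ?_⟩
    simp [hasSum_unique]
  | succ r ih =>
    obtain ⟨htail, htail_sum⟩ := ih (fun i => f i.succ) fun i => hf i.succ
    have hnorm := (hf 0).mul_norm htail
    have hprod := (hf 0).of_norm.hasSum.mul htail_sum hnorm.of_norm
    constructor
    · rw [← (Fin.consEquiv fun _ => ℕ).summable_iff]
      simpa [Function.comp_def, Fin.consEquiv, Fin.prod_univ_succ] using hnorm
    · rw [← (Fin.consEquiv fun _ => ℕ).hasSum_iff]
      simpa [Function.comp_def, Fin.consEquiv, Fin.prod_univ_succ] using hprod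

theorem integrableOn_rpow_mul_exp_neg_mul_Ioi {a b : ℝ} (ha : 0 < a) (hb : 0 < b) :
    IntegrableOn (fun t : ℝ => t ^ (a - 1) * Real.exp (-b * t)) (Set.Ioi 0) := by
  simpa using integrableOn_rpow_mul_exp_neg_mul_rpow (by linarith : -1 < a - 1) one_pos hb

theorem norm_cpow_mul_exp_neg_mul {t : ℝ} (ht : 0 < t) (s z : ℂ) :
    ‖(t : ℂ) ^ (s - 1) * Complex.exp (-z * t)‖ = t ^ (s.re - 1) * Real.exp (-z.re * t) := by
  simp [Complex.norm_cpow_eq_rpow_re_of_pos ht, Complex.norm_exp]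

theorem aestronglyMeasurable_cpow_mul_exp_neg_mul (s z : ℂ) :
    AEStronglyMeasurable (fun t : ℝ => (t : ℂ) ^ (s - 1) * Complex.exp (-z * t))
      (volume.restrict (Set.Ioi 0)) := by
  apply Measurable.aestronglyMeasurable
  fun_prop

theorem integrableOn_cpow_mul_exp_neg_complex_mul_Ioi {s z : ℂ} (hs : 0 < s.re) (hz : 0 < z.re) :
    IntegrableOn (fun t : ℝ => (t : ℂ) ^ (s - 1) * Complex.exp (-z * t)) (Set.Ioi 0) := by
  refine (integrableOn_rpow_mul_exp_neg_mul_Ioi hs hz).mono'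
    (aestronglyMeasurable_cpow_mul_exp_neg_mul s z) ?_
  filter_upwards [ae_restrict_mem measurableSet_Ioi] with t ht
  exact (norm_cpow_mul_exp_neg_mul ht s z).le

theorem differentiableAt_integral_cpow_mul_exp_neg_mul {s z : ℂ} (hs : 0 < s.re)
    (hz : 0 < z.re) :
    DifferentiableAt ℂ
      (fun z : ℂ => ∫ t : ℝ in Set.Ioi 0, (t : ℂ) ^ (s - 1) * Complex.exp (-z * t)) z := by
  have hs' : 0 < (s + 1).re := by simp; linarith
  refine (hasDerivAt_integral_of_dominated_loc_of_deriv_le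
    (F' := fun (y : ℂ) (t : ℝ) => (t : ℂ) ^ (s - 1) * (Complex.exp (-y * t) * (-t)))
    (bound := fun t : ℝ => t ^ ((s + 1).re - 1) * Real.exp (-(z.re / 2) * t))
    (Metric.ball_mem_nhds z (half_pos hz))
    (Filter.Eventually.of_forall fun y => aestronglyMeasurable_cpow_mul_exp_neg_mul s y)
    (integrableOn_cpow_mul_exp_neg_complex_mul_Ioi hs hz) ?_ ?_
    (integrableOn_rpow_mul_exp_neg_mul_Ioi hs' (half_pos hz)) ?_).2.differentiableAt
  · apply Measurable.aestronglyMeasurable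
    fun_prop
  · filter_upwards [ae_restrict_mem measurableSet_Ioi] with t ht y hy
    have ht : 0 < t := ht
    have hre : z.re / 2 ≤ y.re := by
      have h₁ := (Complex.abs_re_le_norm (y - z)).trans_lt (mem_ball_iff_norm.mp hy)
      have h₂ := (abs_lt.mp h₁).1
      simp only [Complex.sub_re] at h₂
      linarith
    rw [← mul_assoc, norm_mul, norm_cpow_mul_exp_neg_mul ht, norm_neg, Complex.norm_real,
      Real.norm_of_nonneg ht.le, Complex.add_re, Complex.one_re, add_sub_cancel_right,
      mul_right_comm, ← Real.rpow_add_one ht.ne', sub_add_cancel]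
    gcongr
  · refine Filter.Eventually.of_forall fun t y _ => ?_
    have h := (((hasDerivAt_id y).neg.mul_const (t : ℂ)).cexp).const_mul ((t : ℂ) ^ (s - 1))
    simpa using h

/-- The Gamma integral with a complex scaling parameter of positive real part. -/
theorem integral_cpow_mul_exp_neg_complex_mul_Ioi {s z : ℂ} (hs : 0 < s.re) (hz : 0 < z.re) :
    ∫ t : ℝ in Set.Ioi 0, (t : ℂ) ^ (s - 1) * Complex.exp (-z * t) =
      Complex.Gamma s * z ^ (-s) := by
  have hopen : IsOpen {z : ℂ | 0 < z.re} := isOpen_lt continuous_const Complex.continuous_re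
  have hleft : AnalyticOnNhd ℂ
      (fun z : ℂ => ∫ t : ℝ in Set.Ioi 0, (t : ℂ) ^ (s - 1) * Complex.exp (-z * t))
      {z : ℂ | 0 < z.re} :=
    DifferentiableOn.analyticOnNhd (fun y hy =>
      (differentiableAt_integral_cpow_mul_exp_neg_mul hs hy).differentiableWithinAt) hopen
  have hright : AnalyticOnNhd ℂ (fun z : ℂ => Complex.Gamma s * z ^ (-s)) {z : ℂ | 0 < z.re} :=
    DifferentiableOn.analyticOnNhd (fun y hy =>
      ((differentiableAt_id.cpow_const (Or.inl hy)).const_mul _).differentiableWithinAt) hopen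
  refine hleft.eqOn_of_preconnected_of_frequently_eq hright
    (convex_halfSpace_re_gt 0).isPreconnected (z₀ := 1) (by simp) ?_ hz
  have htendsto : Filter.Tendsto (fun x : ℝ => (x : ℂ)) (nhdsWithin 1 (Set.Ioi 1))
      (nhdsWithin 1 {1}ᶜ) := by
    refine tendsto_nhdsWithin_iff.mpr ⟨?_, ?_⟩
    · exact (Complex.continuous_ofReal.tendsto' 1 1 (by simp)).mono_left nhdsWithin_le_nhds
    · filter_upwards [self_mem_nhdsWithin] with x hx
      simpa using (ne_of_gt hx : x ≠ 1)
  refine htendsto.frequently (Filter.Eventually.frequently ?_)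
  filter_upwards [self_mem_nhdsWithin] with x hx
  have hx0 : 0 < x := one_pos.trans hx
  have h := Complex.integral_cpow_mul_exp_neg_mul_Ioi hs hx0
  simp only [neg_mul]
  rw [h, one_div, Complex.inv_cpow _ _ (by simp [Complex.arg_ofReal_of_nonneg hx0.le,
    Real.pi_pos.ne]), ← Complex.cpow_neg, mul_comm]

theorem exp_neg_mul_lt_one {a t : ℝ} (ha : 0 < a) (ht : 0 < t) : Real.exp (-a * t) < 1 :=
  Real.exp_lt_one_iff.2 (by nlinarith [mul_pos ha ht])

theorem inv_one_sub_exp_neg_mul_le {a t : ℝ} (ha : 0 < a) (ht : 0 < t) :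
    (1 - Real.exp (-a * t))⁻¹ ≤ 1 + a⁻¹ / t := by
  have hat : 0 < a * t := mul_pos ha ht
  have hexp : Real.exp (-a * t) ≤ (1 + a * t)⁻¹ := by
    rw [neg_mul, Real.exp_neg]
    gcongr
    linarith [Real.add_one_le_exp (a * t)]
  calc (1 - Real.exp (-a * t))⁻¹ ≤ (1 - (1 + a * t)⁻¹)⁻¹ := by
        gcongr
        exact sub_pos.mpr (inv_lt_one_of_one_lt₀ (by linarith))
    _ = 1 + a⁻¹ / t := by
        have : 1 + a * t - 1 ≠ 0 := by simpa using hat.ne'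
        field_simp
        ring_nf

theorem integrableOn_prod_inv_one_sub_exp_mul {r : ℕ} {a : Fin r → ℝ} (ha : ∀ j, 0 < a j)
    {b σ : ℝ} (hb : 0 < b) (hσ : (r : ℝ) < σ) :
    IntegrableOn (fun t : ℝ => (∏ j, (1 - Real.exp (-a j * t))⁻¹) *
      (t ^ (σ - 1) * Real.exp (-b * t))) (Set.Ioi 0) := by
  have hdom : IntegrableOn (fun t : ℝ => (∏ j, (1 + (a j)⁻¹ / t)) *
      (t ^ (σ - 1) * Real.exp (-b * t))) (Set.Ioi 0) := by
    induction r generalizing σ with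
    | zero => simpa using integrableOn_rpow_mul_exp_neg_mul_Ioi (by simpa using hσ) hb
    | succ r ih =>
      push_cast at hσ
      have h₁ := ih (fun j => ha j.succ) (σ := σ) (by linarith)
      have h₂ := (ih (fun j => ha j.succ) (σ := σ - 1) (by linarith)).const_mul (a 0)⁻¹
      refine (h₁.add h₂).congr_fun (fun t ht => ?_) measurableSet_Ioi
      have ht : 0 < t := ht
      simp only [Pi.add_apply, Fin.prod_univ_succ]
      rw [Real.rpow_sub_one ht.ne' (σ - 1)]
      ring
  refine hdom.mono' (Measurable.aestronglyMeasurable (by fun_prop)) ?_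
  filter_upwards [ae_restrict_mem measurableSet_Ioi] with t ht
  have ht : 0 < t := ht
  have hpos (j : Fin r) : 0 ≤ (1 - Real.exp (-a j * t))⁻¹ :=
    inv_nonneg.mpr (sub_nonneg.mpr (exp_neg_mul_lt_one (ha j) ht).le)
  rw [Real.norm_of_nonneg (mul_nonneg (Finset.prod_nonneg fun j _ => hpos j) (by positivity))]
  gcongr with j
  · exact fun j _ => hpos j
  · exact inv_one_sub_exp_neg_mul_le (ha j) ht

theorem norm_exp_neg_mul_ofReal (z : ℂ) (t : ℝ) :
    ‖Complex.exp (-z * t)‖ = Real.exp (-z.re * t) := by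
  simp [Complex.norm_exp]

theorem norm_fprod_le {r : ℕ} {ω : Fin r → ℂ} (hω : ∀ j, 0 < (ω j).re) {t : ℝ} (ht : 0 < t) :
    ‖fprod r ω t‖ ≤ ∏ j, (1 - Real.exp (-(ω j).re * t))⁻¹ := by
  rw [fprod, norm_prod]
  gcongr with j
  rw [norm_inv]
  have h := norm_sub_norm_le 1 (Complex.exp (-ω j * t))
  rw [norm_one, norm_exp_neg_mul_ofReal] at h
  have := exp_neg_mul_lt_one (hω j) ht
  gcongr

theorem hasSum_prod_exp_pow_fprod {r : ℕ} {ω : Fin r → ℂ} (hω : ∀ j, 0 < (ω j).re) {t : ℝ}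
    (ht : 0 < t) :
    HasSum (fun n : Fin r → ℕ => ∏ j, Complex.exp (-ω j * t) ^ n j) (fprod r ω t) := by
  have hlt (j : Fin r) : ‖Complex.exp (-ω j * t)‖ < 1 := by
    rw [norm_exp_neg_mul_ofReal]
    exact exp_neg_mul_lt_one (hω j) ht
  have h := (summable_norm_and_hasSum_fin_prod r (fun j k => Complex.exp (-ω j * t) ^ k)
    fun j => summable_norm_geometric_of_norm_lt_one (hlt j)).2
  simpa only [fprod, tsum_geometric_of_norm_lt_one (hlt _)] using h

theorem hasSum_prod_real_exp_pow {r : ℕ} {a : Fin r → ℝ} (ha : ∀ j, 0 < a j) {t : ℝ}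
    (ht : 0 < t) :
    HasSum (fun n : Fin r → ℕ => ∏ j, Real.exp (-a j * t) ^ n j)
      (∏ j, (1 - Real.exp (-a j * t))⁻¹) := by
  have hlt (j : Fin r) : ‖Real.exp (-a j * t)‖ < 1 := by
    rw [Real.norm_of_nonneg (Real.exp_pos _).le]
    exact exp_neg_mul_lt_one (ha j) ht
  have h := (summable_norm_and_hasSum_fin_prod r (fun j k => Real.exp (-a j * t) ^ k)
    fun j => summable_norm_geometric_of_norm_lt_one (hlt j)).2
  simpa only [tsum_geometric_of_norm_lt_one (hlt _)] using h

theorem prod_exp_pow_mul_exp {r : ℕ} (ω : Fin r → ℂ) (w t : ℂ) (n : Fin r → ℕ) :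
    (∏ j, Complex.exp (-ω j * t) ^ n j) * Complex.exp (-w * t) =
      Complex.exp (-(∑ j, (n j : ℂ) * ω j + w) * t) := by
  simp_rw [← Complex.exp_nat_mul]
  rw [← Complex.exp_sum, ← Complex.exp_add, neg_add, add_mul, neg_mul (∑ j, _), Finset.sum_mul,
    ← Finset.sum_neg_distrib]
  congr 3 with j
  ring

/-- For `Re ω_j > 0`, `Re w > 0` and `Re s > r`, the integral
`∫_0^∞ f_ω(t) e^{-wt} t^{s-1} dt` converges absolutely and equals `Γ(s)·ζ_r(s,w;ω)`. -/
theorem gamma_mul_multiple_hurwitz_zeta_eq_integral (r : ℕ) (ω : Fin r → ℂ)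
    (hω : ∀ j, 0 < (ω j).re) (w : ℂ) (hw : 0 < w.re) (s : ℂ) (hs : (r : ℝ) < s.re) :
    IntegrableOn
      (fun t : ℝ => fprod r ω t * Complex.exp (-w * t) * (t : ℂ) ^ (s - 1))
      (Set.Ioi (0 : ℝ)) ∧
    Complex.Gamma s * (∑' n : Fin r → ℕ, (∑ i, (n i : ℂ) * ω i + w) ^ (-s)) =
      ∫ t in Set.Ioi (0 : ℝ), fprod r ω t * Complex.exp (-w * t) * (t : ℂ) ^ (s - 1) := by
  have hs0 : 0 < s.re := (Nat.cast_nonneg r).trans_lt hs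
  have hmajorant := integrableOn_prod_inv_one_sub_exp_mul hω hw hs
  constructor
  · refine hmajorant.mono' (Measurable.aestronglyMeasurable (by unfold fprod; fun_prop)) ?_
    filter_upwards [ae_restrict_mem measurableSet_Ioi] with t ht
    rw [mul_assoc, mul_comm (Complex.exp _), norm_mul, norm_cpow_mul_exp_neg_mul ht]
    have ht : 0 < t := ht
    gcongr
    exact norm_fprod_le hω ht
  · have hre (n : Fin r → ℕ) : 0 < (∑ j, (n j : ℂ) * ω j + w).re := by
      have : 0 ≤ ∑ j, (n j : ℝ) * (ω j).re :=
        Finset.sum_nonneg fun j _ => mul_nonneg (Nat.cast_nonneg _) (hω j).le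
      simp
      linarith
    have hterm (n : Fin r → ℕ) (t : ℝ) :
        (∏ j, Complex.exp (-ω j * t) ^ n j) * Complex.exp (-w * t) * (t : ℂ) ^ (s - 1) =
          (t : ℂ) ^ (s - 1) * Complex.exp (-(∑ j, (n j : ℂ) * ω j + w) * t) := by
      rw [prod_exp_pow_mul_exp, mul_comm]
    have hbound {t : ℝ} (ht : t ∈ Set.Ioi (0 : ℝ)) :=
      (hasSum_prod_real_exp_pow hω ht).mul_right (t ^ (s.re - 1) * Real.exp (-w.re * t))
    have hsum := hasSum_integral_of_dominated_convergence (μ := volume.restrict (Set.Ioi 0))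
      (F := fun (n : Fin r → ℕ) (t : ℝ) =>
        (∏ j, Complex.exp (-ω j * t) ^ n j) * Complex.exp (-w * t) * (t : ℂ) ^ (s - 1))
      (f := fun t : ℝ => fprod r ω t * Complex.exp (-w * t) * (t : ℂ) ^ (s - 1))
      (fun n t => (∏ j, Real.exp (-(ω j).re * t) ^ n j) *
        (t ^ (s.re - 1) * Real.exp (-w.re * t)))
      (fun n => Measurable.aestronglyMeasurable (by fun_prop))
      (fun n => by
        filter_upwards [ae_restrict_mem measurableSet_Ioi] with t ht
        rw [mul_assoc, mul_comm (Complex.exp (-w * t)), norm_mul, norm_cpow_mul_exp_neg_mul ht]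
        simp only [norm_prod, norm_pow, norm_exp_neg_mul_ofReal, le_refl])
      (by
        filter_upwards [ae_restrict_mem measurableSet_Ioi] with t ht
        exact (hbound ht).summable)
      (hmajorant.congr_fun (fun t ht => (hbound ht).tsum_eq.symm) measurableSet_Ioi)
      (by
        filter_upwards [ae_restrict_mem measurableSet_Ioi] with t ht
        exact ((hasSum_prod_exp_pow_fprod hω ht).mul_right _).mul_right _)
    simp_rw [hterm, integral_cpow_mul_exp_neg_complex_mul_Ioi hs0 (hre _)] at hsum
    rw [← tsum_mul_left, hsum.tsum_eq]
end

section
/- Let r ≥ 0 be an integer, ω = (ω_1,…,ω_r) complex numbers with Re ω_j > 0, and w ∈ ℂ. For every integer n ≥ −r, a_{r,n}(w;ω) = (1/(ω_1⋯ω_r)) · ∑_{n_0,…,n_r ≥ 0, n_0+⋯+n_r = n+r} [w^{n_0}(|ω| − 1)^{n_0}/n_0!] · ∏_{j=1}^r [B_{n_j}(w)(−ω_j)^{n_j}/n_j!], where |ω| = ω_1 + ⋯ + ω_r. -/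
/-- `IsMBernoulli r ω w a` says that `a : ℤ → ℂ` is the family of multiple Bernoulli
polynomial values `a_{r,n}(w;ω)`: the Laurent coefficients of `f_ω(t)·exp(-wt)` at `t = 0`,
i.e. `a n` is the `(n+r)`-th Taylor coefficient at `0` of the holomorphic extension of
`t^r · f_ω(t) · exp(-wt)`, with `a n = 0` for `n < -r`. -/
def IsMBernoulli (r : ℕ) (ω : Fin r → ℂ) (w : ℂ) (a : ℤ → ℂ) : Prop :=
  (∀ n : ℤ, n < -(r : ℤ) → a n = 0) ∧
  ∃ g : ℂ → ℂ, AnalyticAt ℂ g 0 ∧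
    (∀ᶠ t in nhdsWithin (0 : ℂ) {(0 : ℂ)}ᶜ,
      g t = t ^ r * fprod r ω t * Complex.exp (-w * t)) ∧
    (∀ n : ℤ, -(r : ℤ) ≤ n →
      a n = iteratedDeriv (n + r).toNat g 0 / ((n + r).toNat.factorial : ℂ))

open PowerSeries in
/-- Coefficients of a product of finitely many power series, as a sum over tuples. -/
lemma PowerSeries.coeff_prod_eq_sum_antidiagonalTuple {R : Type*} [CommSemiring R] (k n : ℕ)
    (f : Fin k → R⟦X⟧) :
    coeff n (∏ i, f i) = ∑ v ∈ Finset.Nat.antidiagonalTuple k n, ∏ i, coeff (v i) (f i) := by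
  rw [PowerSeries.coeff_prod]
  refine Finset.sum_bij (fun l _ => ⇑l) ?_ ?_ ?_ ?_
  · intro l hl
    simpa [Finset.Nat.mem_antidiagonalTuple] using hl
  · intro l _ l' _ h
    exact DFunLike.coe_injective h
  · intro v hv
    exact ⟨Finsupp.equivFunOnFinite.symm v,
      by simpa [Finset.Nat.mem_antidiagonalTuple] using hv, by simp⟩
  · intro l _
    rfl

open PowerSeries in
lemma PowerSeries.prod_rescale_exp {ι A : Type*} [CommRing A] [Algebra ℚ A] (s : Finset ι)
    (c : ι → A) : ∏ j ∈ s, rescale (c j) (exp A) = rescale (∑ j ∈ s, c j) (exp A) := by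
  classical
  induction s using Finset.induction_on with
  | empty => simp
  | insert j s hj ih =>
    rw [Finset.prod_insert hj, Finset.sum_insert hj, ih, exp_mul_exp_eq_exp_add]

/-- The Taylor series at `0` of a function, as a formal power series. -/
noncomputable def taylorSeriesAtZero (g : ℂ → ℂ) : PowerSeries ℂ :=
  PowerSeries.mk fun n => iteratedDeriv n g 0 / (n.factorial : ℂ)

lemma taylorSeriesAtZero_mul {f g : ℂ → ℂ} (hf : AnalyticAt ℂ f 0) (hg : AnalyticAt ℂ g 0) :
    taylorSeriesAtZero (f * g) = taylorSeriesAtZero f * taylorSeriesAtZero g := by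
  ext n
  rw [PowerSeries.coeff_mul, Finset.Nat.sum_antidiagonal_eq_sum_range_succ_mk]
  simp only [taylorSeriesAtZero, PowerSeries.coeff_mk]
  rw [iteratedDeriv_mul hf.contDiffAt hg.contDiffAt, Finset.sum_div]
  refine Finset.sum_congr rfl fun i hi => ?_
  have hi : i ≤ n := Nat.lt_succ_iff.mp (Finset.mem_range.mp hi)
  rw [Nat.cast_choose ℂ hi]
  have := n.factorial_ne_zero
  field_simp

lemma taylorSeriesAtZero_prod {ι : Type*} (s : Finset ι) (f : ι → ℂ → ℂ)
    (hf : ∀ j ∈ s, AnalyticAt ℂ (f j) 0) :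
    taylorSeriesAtZero (∏ j ∈ s, f j) = ∏ j ∈ s, taylorSeriesAtZero (f j) := by
  classical
  induction s using Finset.induction_on with
  | empty =>
    ext n
    rcases n with _ | n <;>
      simp [taylorSeriesAtZero, PowerSeries.coeff_one, Pi.one_def, iteratedDeriv_const]
  | insert j s hj ih =>
    rw [Finset.prod_insert hj, Finset.prod_insert hj,
      taylorSeriesAtZero_mul (hf j (Finset.mem_insert_self j s))
        (Finset.analyticAt_prod s fun i hi => hf i (Finset.mem_insert_of_mem hi)),
      ih fun i hi => hf i (Finset.mem_insert_of_mem hi)]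

lemma taylorSeriesAtZero_congr {f g : ℂ → ℂ} (h : f =ᶠ[nhds 0] g) :
    taylorSeriesAtZero f = taylorSeriesAtZero g := by
  ext n
  simp [taylorSeriesAtZero, h.iteratedDeriv_eq n]

lemma taylorSeriesAtZero_pow (r : ℕ) :
    taylorSeriesAtZero (fun t => t ^ r) = (PowerSeries.X : PowerSeries ℂ) ^ r := by
  ext n
  simp only [taylorSeriesAtZero, PowerSeries.coeff_mk, iteratedDeriv_fun_pow_zero,
    PowerSeries.coeff_X_pow]
  split_ifs with h
  · subst h
    exact div_self (Nat.cast_ne_zero.mpr n.factorial_ne_zero)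
  · simp

lemma taylorSeriesAtZero_exp (c : ℂ) :
    taylorSeriesAtZero (fun t => Complex.exp (c * t)) =
      PowerSeries.rescale c (PowerSeries.exp ℂ) := by
  ext n
  simp [taylorSeriesAtZero, iteratedDeriv_cexp_const_mul, PowerSeries.coeff_rescale,
    PowerSeries.coeff_exp, div_eq_mul_inv]

lemma taylorSeriesAtZero_one_sub_exp (c : ℂ) :
    taylorSeriesAtZero (fun t => 1 - Complex.exp (c * t)) =
      1 - PowerSeries.rescale c (PowerSeries.exp ℂ) := by
  rw [← taylorSeriesAtZero_exp]
  ext n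
  rcases n with _ | n
  · simp [taylorSeriesAtZero]
  · simp [taylorSeriesAtZero, PowerSeries.coeff_one, iteratedDeriv_const_sub, neg_div]

lemma eventually_one_sub_exp_ne_zero {c : ℂ} (hc : c ≠ 0) :
    ∀ᶠ t in nhdsWithin (0 : ℂ) {(0 : ℂ)}ᶜ, 1 - Complex.exp (c * t) ≠ 0 := by
  have h : HasDerivAt (fun t : ℂ => 1 - Complex.exp (c * t)) (-c) 0 := by
    simpa using (((hasDerivAt_id (0 : ℂ)).const_mul c).cexp).const_sub 1
  exact h.eventually_ne (neg_ne_zero.mpr hc)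

/-- The functional equation of the generating function, transferred to formal power series. -/
lemma taylorSeriesAtZero_mul_prod_one_sub_exp {r : ℕ} {ω : Fin r → ℂ} (hω : ∀ j, ω j ≠ 0) {w : ℂ}
    {g : ℂ → ℂ} (hg : AnalyticAt ℂ g 0)
    (hgf : ∀ᶠ t in nhdsWithin (0 : ℂ) {(0 : ℂ)}ᶜ,
      g t = t ^ r * fprod r ω t * Complex.exp (-w * t)) :
    taylorSeriesAtZero g * ∏ j, (1 - PowerSeries.rescale (-ω j) (PowerSeries.exp ℂ)) =
      PowerSeries.X ^ r * PowerSeries.rescale (-w) (PowerSeries.exp ℂ) := by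
  have hfac : ∀ j ∈ Finset.univ, AnalyticAt ℂ (fun t => 1 - Complex.exp (-ω j * t)) 0 :=
    fun j _ => by fun_prop
  have hprod := Finset.analyticAt_prod Finset.univ hfac
  have hpow : AnalyticAt ℂ (fun t : ℂ => t ^ r) 0 := by fun_prop
  have hexp : AnalyticAt ℂ (fun t : ℂ => Complex.exp (-w * t)) 0 := by fun_prop
  simp_rw [← taylorSeriesAtZero_one_sub_exp]
  rw [← taylorSeriesAtZero_prod _ _ hfac, ← taylorSeriesAtZero_exp, ← taylorSeriesAtZero_pow,
    ← taylorSeriesAtZero_mul hg hprod, ← taylorSeriesAtZero_mul hpow hexp]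
  refine taylorSeriesAtZero_congr ?_
  rw [← ContinuousAt.eventuallyEq_nhds_iff_eventuallyEq_nhdsNE
    (hg.mul hprod).continuousAt (hpow.mul hexp).continuousAt]
  have hne := Filter.eventually_all.mpr
    fun j => eventually_one_sub_exp_ne_zero (neg_ne_zero.mpr (hω j))
  filter_upwards [hgf, hne] with t ht hne
  have hcancel : fprod r ω t * ∏ j, (1 - Complex.exp (-ω j * t)) = 1 := by
    rw [fprod, ← Finset.prod_mul_distrib]
    exact Finset.prod_eq_one fun j _ => inv_mul_cancel₀ (hne j)
  simp only [Pi.mul_apply, Finset.prod_apply, ht]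
  linear_combination (t ^ r * Complex.exp (-w * t)) * hcancel

/-- The exponential generating series of the Bernoulli polynomials at `w`, rescaled by `c`. -/
noncomputable def bernoulliSeries (w c : ℂ) : PowerSeries ℂ :=
  PowerSeries.mk fun n =>
    Polynomial.aeval w (Polynomial.bernoulli n) * c ^ n / (n.factorial : ℂ)

open PowerSeries in
lemma bernoulliSeries_mul_one_sub_exp (w c : ℂ) :
    bernoulliSeries w (-c) * (1 - rescale (-c) (exp ℂ)) =
      C c * X * rescale (-(w * c)) (exp ℂ) := by
  have h := congrArg (rescale (-c)) (Polynomial.bernoulli_generating_function w)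
  have hB : rescale (-c) (mk fun n => Polynomial.aeval w
      ((1 / n.factorial : ℚ) • Polynomial.bernoulli n)) = bernoulliSeries w (-c) := by
    ext n
    simp only [bernoulliSeries, coeff_rescale, coeff_mk, map_smul, Rat.smul_def]
    push_cast
    ring
  rw [map_mul, map_mul, map_sub, map_one, hB, rescale_rescale, rescale_X, mul_neg, map_neg] at h
  linear_combination -h

open PowerSeries in
lemma rescale_exp_mul_prod_bernoulliSeries {r : ℕ} (ω : Fin r → ℂ) (w : ℂ) :
    (rescale (w * ((∑ j, ω j) - 1)) (exp ℂ) * ∏ j, bernoulliSeries w (-ω j)) *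
        ∏ j, (1 - rescale (-ω j) (exp ℂ)) =
      C (∏ j, ω j) * (X ^ r * rescale (-w) (exp ℂ)) := by
  rw [mul_assoc, ← Finset.prod_mul_distrib]
  simp_rw [bernoulliSeries_mul_one_sub_exp]
  rw [Finset.prod_mul_distrib, Finset.prod_mul_distrib, prod_rescale_exp, ← map_prod]
  have hsum : w * ((∑ j, ω j) - 1) + ∑ j, -(w * ω j) = -w := by
    rw [Finset.sum_neg_distrib, ← Finset.mul_sum]
    ring
  have hexp := exp_mul_exp_eq_exp_add (A := ℂ) (w * ((∑ j, ω j) - 1)) (∑ j, -(w * ω j))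
  rw [hsum] at hexp
  rw [← hexp]
  simp only [Finset.prod_const, Finset.card_univ, Fintype.card_fin]
  ring

lemma one_sub_rescale_exp_ne_zero {c : ℂ} (hc : c ≠ 0) :
    1 - PowerSeries.rescale c (PowerSeries.exp ℂ) ≠ 0 := by
  intro h
  have := congrArg (PowerSeries.coeff 1) h
  simp [PowerSeries.coeff_one, PowerSeries.coeff_rescale, PowerSeries.coeff_exp, hc] at this

/-- Explicit formula for the multiple Bernoulli polynomials in terms of
the classical Bernoulli polynomials:
`a_{r,n}(w;ω) = (ω_1⋯ω_r)⁻¹ ∑_{n_0+⋯+n_r = n+r} [w^{n_0}(|ω|-1)^{n_0}/n_0!]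
  ∏_j [B_{n_j}(w)(-ω_j)^{n_j}/n_j!]`. -/
theorem multiple_bernoulli_eq_sum (r : ℕ) (ω : Fin r → ℂ) (hω : ∀ j, 0 < (ω j).re)
    (w : ℂ) (a : ℤ → ℂ) (ha : IsMBernoulli r ω w a) (n : ℤ) (hn : -(r : ℤ) ≤ n) :
    a n = (∏ j, ω j)⁻¹ *
      ∑ v ∈ Finset.Nat.antidiagonalTuple (r + 1) (n + r).toNat,
        (w ^ (v 0) * ((∑ j, ω j) - 1) ^ (v 0) / ((v 0).factorial : ℂ)) *
        ∏ j : Fin r,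
          (Polynomial.aeval w (Polynomial.bernoulli (v j.succ)) *
            (-(ω j)) ^ (v j.succ) / ((v j.succ).factorial : ℂ)) := by
  obtain ⟨-, g, hg, hgf, hcoeff⟩ := ha
  have hω' : ∀ j, ω j ≠ 0 := fun j h => by simpa [h] using hω j
  have hprod : ∏ j, ω j ≠ 0 := Finset.prod_ne_zero_iff.mpr fun j _ => hω' j
  have hne : ∏ j, (1 - PowerSeries.rescale (-ω j) (PowerSeries.exp ℂ)) ≠ 0 :=
    Finset.prod_ne_zero_iff.mpr fun j _ => one_sub_rescale_exp_ne_zero (neg_ne_zero.mpr (hω' j))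
  have hseries : PowerSeries.C (∏ j, ω j) * taylorSeriesAtZero g =
      PowerSeries.rescale (w * ((∑ j, ω j) - 1)) (PowerSeries.exp ℂ) *
        ∏ j, bernoulliSeries w (-ω j) := by
    refine mul_right_cancel₀ hne ?_
    rw [rescale_exp_mul_prod_bernoulliSeries, mul_assoc,
      taylorSeriesAtZero_mul_prod_one_sub_exp hω' hg hgf]
  have hn' := congrArg (PowerSeries.coeff (n + r).toNat) hseries
  have hcons := PowerSeries.coeff_prod_eq_sum_antidiagonalTuple (r + 1) (n + r).toNat
    (Fin.cons (PowerSeries.rescale (w * ((∑ j, ω j) - 1)) (PowerSeries.exp ℂ))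
      fun j => bernoulliSeries w (-ω j))
  simp only [Fin.prod_univ_succ, Fin.cons_zero, Fin.cons_succ] at hcons
  rw [hcons, PowerSeries.coeff_C_mul, taylorSeriesAtZero, PowerSeries.coeff_mk, ← hcoeff n hn]
    at hn'
  rw [eq_inv_mul_iff_mul_eq₀ hprod, hn']
  refine Finset.sum_congr rfl fun v _ => ?_
  simp [bernoulliSeries, PowerSeries.coeff_rescale, PowerSeries.coeff_exp, mul_pow, div_eq_mul_inv]
end

section
/- Let r ≥ 0 be an integer, ω = (ω_1,…,ω_r) complex numbers with Re ω_j > 0, and w ∈ ℂ with Re w > 0. Then (i) there exists a function F : ℂ → ℂ that is holomorphic on ℂ ∖ {1, 2, …, r} and satisfies F(s) = ∑_{n ∈ (ℤ_{≥0})^r} (n·ω + w)^{−s} for every s with Re s > r; and (ii) every such F satisfies F(−n) = (−1)^n · n! · a_{r,n}(w;ω) for every integer n ≥ 0. -/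
open Set Filter Topology MeasureTheory Asymptotics

theorem hasSum_pi_geometric : ∀ (r : ℕ) (x : Fin r → ℂ), (∀ j, ‖x j‖ < 1) →
    HasSum (fun n : Fin r → ℕ => ∏ j, x j ^ n j) (∏ j, (1 - x j)⁻¹) ∧
    Summable (fun n : Fin r → ℕ => ‖∏ j, x j ^ n j‖)
  | 0, x, _ => by
    constructor
    · simp
    · exact (hasSum_unique _).summable
  | r + 1, x, hx => by
    obtain ⟨hs, hn⟩ := hasSum_pi_geometric r (fun j => x j.succ) (fun j => hx j.succ)
    have h0 := hasSum_geometric_of_norm_lt_one (hx 0)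
    have h0n : Summable (fun n : ℕ => ‖x 0 ^ n‖) := by
      simpa using summable_geometric_of_lt_one (norm_nonneg _) (hx 0)
    have hmul := h0n.mul_norm hn
    have hsum := h0.mul hs hmul.of_norm
    constructor
    · rw [← (Fin.consEquiv fun _ => ℕ).hasSum_iff, Fin.prod_univ_succ]
      refine hsum.congr_fun ?_
      intro p
      simp [Fin.consEquiv, Fin.prod_univ_succ]
    · rw [← (Fin.consEquiv fun _ => ℕ).summable_iff]
      refine hmul.congr ?_
      intro p
      simp [Fin.consEquiv, Fin.prod_univ_succ]

theorem integrableOn_cpow_mul_exp_neg_mul {s z : ℂ} (hs : 0 < s.re) (hz : 0 < z.re) :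
    IntegrableOn (fun t : ℝ => (t : ℂ) ^ (s - 1) * Complex.exp (-z * t)) (Ioi 0) := by
  have hcont : Continuous fun t : ℝ => Complex.exp (-z * t) := by fun_prop
  have h : MellinConvergent (fun t : ℝ => Complex.exp (-z * t)) s := by
    refine mellinConvergent_of_isBigO_rpow_exp (a := z.re) (b := 0) hz ?_ ?_ ?_ hs
    · exact hcont.locallyIntegrable.locallyIntegrableOn _
    · refine IsBigO.of_bound 1 (Eventually.of_forall fun t => ?_)
      simp [Complex.norm_exp]
    · simp only [neg_zero, Real.rpow_zero]
      exact ((hcont.tendsto 0).isBigO_one ℝ).mono nhdsWithin_le_nhds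
  exact h

theorem differentiableAt_integral_cpow_mul_exp {s z : ℂ} (hs : 0 < s.re) (hz : 0 < z.re) :
    DifferentiableAt ℂ
      (fun z : ℂ => ∫ t : ℝ in Ioi 0, (t : ℂ) ^ (s - 1) * Complex.exp (-z * t)) z := by
  have hs' : 0 < (s + 1).re := by simp; linarith
  have hz2 : 0 < ((z.re / 2 : ℝ) : ℂ).re := by simp; linarith
  refine (hasDerivAt_integral_of_dominated_loc_of_deriv_le (μ := volume.restrict (Ioi (0 : ℝ)))
    (F := fun z (t : ℝ) => (t : ℂ) ^ (s - 1) * Complex.exp (-z * t))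
    (F' := fun z (t : ℝ) => (t : ℂ) ^ (s - 1) * (Complex.exp (-z * t) * (-1 * t)))
    (bound := fun t : ℝ => ‖(t : ℂ) ^ (s + 1 - 1) * Complex.exp (-((z.re / 2 : ℝ) : ℂ) * t)‖)
    (s := Metric.ball z (z.re / 2)) (Metric.ball_mem_nhds z (by linarith)) ?_
    (integrableOn_cpow_mul_exp_neg_mul hs hz) ?_ ?_
    (integrableOn_cpow_mul_exp_neg_mul hs' hz2).norm ?_).2.differentiableAt
  · filter_upwards [(isOpen_lt continuous_const Complex.continuous_re).mem_nhds hz] with y hy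
    exact (integrableOn_cpow_mul_exp_neg_mul hs hy).aestronglyMeasurable
  · have := (integrableOn_cpow_mul_exp_neg_mul hs' hz).neg.aestronglyMeasurable
    refine this.congr ?_
    filter_upwards [ae_restrict_mem measurableSet_Ioi] with t ht
    have ht' : (t : ℂ) ≠ 0 := by exact_mod_cast (ne_of_gt ht : t ≠ 0)
    simp only [Pi.neg_apply]
    rw [show s + 1 - 1 = (s - 1) + 1 by ring, Complex.cpow_add _ _ ht', Complex.cpow_one]
    ring
  · filter_upwards [ae_restrict_mem measurableSet_Ioi] with t ht y hy
    have ht0 : (0 : ℝ) < t := ht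
    have ht' : (t : ℂ) ≠ 0 := by exact_mod_cast ht0.ne'
    have hre : z.re / 2 ≤ y.re := by
      have h1 : |(y - z).re| < z.re / 2 :=
        lt_of_le_of_lt (Complex.abs_re_le_norm _) (by simpa [dist_eq_norm] using hy)
      rw [abs_lt, Complex.sub_re] at h1
      linarith
    rw [show s + 1 - 1 = (s - 1) + 1 by ring, Complex.cpow_add _ _ ht', Complex.cpow_one]
    simp only [norm_mul, Complex.norm_exp, norm_neg, norm_one, one_mul]
    rw [mul_assoc, mul_comm ‖(t : ℂ)‖]
    have he : (-y * (t : ℂ)).re ≤ (-((z.re / 2 : ℝ) : ℂ) * t).re := by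
      simpa using mul_le_mul_of_nonneg_right hre ht0.le
    exact mul_le_mul_of_nonneg_left
      (mul_le_mul_of_nonneg_right (Real.exp_le_exp.2 he) (norm_nonneg _)) (norm_nonneg _)
  · filter_upwards with t y _
    have h1 : HasDerivAt (fun y : ℂ => -y * (t : ℂ)) (-1 * t) y :=
      (hasDerivAt_neg y).mul_const _
    exact (h1.cexp).const_mul _

theorem integral_cpow_mul_exp_neg_mul_complex {s z : ℂ} (hs : 0 < s.re) (hz : 0 < z.re) :
    ∫ t : ℝ in Ioi 0, (t : ℂ) ^ (s - 1) * Complex.exp (-z * t) = z ^ (-s) * Complex.Gamma s := by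
  have hopen : IsOpen {z : ℂ | 0 < z.re} := isOpen_lt continuous_const Complex.continuous_re
  have hL : AnalyticOnNhd ℂ
      (fun z : ℂ => ∫ t : ℝ in Ioi 0, (t : ℂ) ^ (s - 1) * Complex.exp (-z * t))
      {z : ℂ | 0 < z.re} :=
    DifferentiableOn.analyticOnNhd
      (fun z hz => (differentiableAt_integral_cpow_mul_exp hs hz).differentiableWithinAt) hopen
  have hR : AnalyticOnNhd ℂ (fun z : ℂ => z ^ (-s) * Complex.Gamma s) {z : ℂ | 0 < z.re} := by
    refine DifferentiableOn.analyticOnNhd (fun z hz => ?_) hopen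
    have : z ∈ Complex.slitPlane := Or.inl hz
    exact ((differentiableAt_id.cpow_const this).mul_const _).differentiableWithinAt
  refine hL.eqOn_of_preconnected_of_frequently_eq hR
    (convex_halfSpace_re_gt 0).isPreconnected (z₀ := 1) (by simp) ?_ hz
  have ht : Tendsto (fun x : ℝ => (x : ℂ)) (𝓝[>] 1) (𝓝[≠] 1) := by
    refine tendsto_nhdsWithin_iff.2 ⟨?_, ?_⟩
    · exact (Complex.continuous_ofReal.tendsto' 1 1 (by simp)).mono_left nhdsWithin_le_nhds
    · filter_upwards [self_mem_nhdsWithin] with x hx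
      simpa using (ne_of_gt hx : x ≠ 1)
  refine ht.frequently (Eventually.frequently ?_)
  filter_upwards [self_mem_nhdsWithin] with x hx
  have hx0 : 0 < x := lt_trans one_pos hx
  have := Complex.integral_cpow_mul_exp_neg_mul_Ioi hs hx0
  simp only [neg_mul]
  have harg : (x : ℂ).arg ≠ Real.pi := by
    simp [Complex.arg_ofReal_of_nonneg hx0.le, Real.pi_pos.ne]
  rw [this, one_div, Complex.inv_cpow _ _ harg, Complex.cpow_neg]

/-- The function `t ↦ f_ω(t) exp(-wt)` restricted to the real line. -/
noncomputable def expProd (r : ℕ) (ω : Fin r → ℂ) (w : ℂ) (t : ℝ) : ℂ :=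
  fprod r ω t * Complex.exp (-w * t)

theorem norm_exp_neg_mul_lt_one {z : ℂ} (hz : 0 < z.re) {t : ℝ} (ht : 0 < t) :
    ‖Complex.exp (-z * t)‖ < 1 := by
  rw [Complex.norm_exp, Real.exp_lt_one_iff]
  simpa using mul_pos hz ht

theorem one_sub_exp_neg_mul_ne_zero {z : ℂ} (hz : 0 < z.re) {t : ℝ} (ht : 0 < t) :
    1 - Complex.exp (-z * t) ≠ 0 := by
  intro h
  have := norm_exp_neg_mul_lt_one hz ht
  rw [← sub_eq_zero.1 h] at this
  simp at this

theorem norm_inv_one_sub_exp_le {z : ℂ} (hz : 0 < z.re) {t : ℝ} (ht : 0 < t) :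
    ‖(1 - Complex.exp (-z * t))⁻¹‖ ≤ 1 + z.re⁻¹ * t⁻¹ := by
  have hx : 0 < z.re * t := mul_pos hz ht
  have h1 : 1 - Real.exp (-(z.re * t)) ≤ ‖1 - Complex.exp (-z * t)‖ := by
    have := norm_sub_norm_le (1 : ℂ) (Complex.exp (-z * t))
    simpa [Complex.norm_exp] using this
  have h2 : (z.re * t) / (1 + z.re * t) ≤ 1 - Real.exp (-(z.re * t)) := by
    have h3 : Real.exp (-(z.re * t)) ≤ (1 + z.re * t)⁻¹ := by
      rw [Real.exp_neg]
      exact inv_anti₀ (by positivity) (by linarith [Real.add_one_le_exp (z.re * t)])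
    have h4 : (z.re * t) / (1 + z.re * t) = 1 - (1 + z.re * t)⁻¹ := by
      field_simp
      ring
    linarith
  rw [norm_inv]
  calc ‖1 - Complex.exp (-z * t)‖⁻¹ ≤ ((z.re * t) / (1 + z.re * t))⁻¹ :=
        inv_anti₀ (by positivity) (h2.trans h1)
    _ = 1 + z.re⁻¹ * t⁻¹ := by
        field_simp
        ring

theorem continuousOn_expProd {r : ℕ} {ω : Fin r → ℂ} (hω : ∀ j, 0 < (ω j).re) (w : ℂ) :
    ContinuousOn (expProd r ω w) (Ioi 0) := by
  unfold expProd fprod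
  refine ContinuousOn.mul (continuousOn_finsetProd _ fun j _ => ?_) (by fun_prop)
  exact ContinuousOn.inv₀ (by fun_prop) fun t ht => one_sub_exp_neg_mul_ne_zero (hω j) ht

theorem expProd_isBigO_exp {r : ℕ} {ω : Fin r → ℂ} (hω : ∀ j, 0 < (ω j).re) (w : ℂ) :
    expProd r ω w =O[atTop] fun t => Real.exp (-w.re * t) := by
  refine IsBigO.of_bound (∏ j, (1 + (ω j).re⁻¹)) ?_
  filter_upwards [eventually_ge_atTop 1] with t ht
  have ht0 : 0 < t := by linarith
  rw [expProd, fprod, norm_mul, norm_prod, Complex.norm_exp]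
  have h : ∏ j, ‖(1 - Complex.exp (-(ω j) * t))⁻¹‖ ≤ ∏ j, (1 + (ω j).re⁻¹) := by
    refine Finset.prod_le_prod (fun _ _ => norm_nonneg _) fun j _ =>
      (norm_inv_one_sub_exp_le (hω j) ht0).trans ?_
    have := mul_le_mul_of_nonneg_left (inv_le_one_of_one_le₀ ht) (inv_pos.2 (hω j)).le
    linarith
  simpa using mul_le_mul_of_nonneg_right h (Real.exp_nonneg (-w.re * t))

theorem expProd_isBigO_rpow {r : ℕ} {ω : Fin r → ℂ} (hω : ∀ j, 0 < (ω j).re) {w : ℂ}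
    (hw : 0 < w.re) :
    expProd r ω w =O[𝓝[>] 0] fun t => t ^ (-(r : ℝ)) := by
  refine IsBigO.of_bound (∏ j, (1 + (ω j).re⁻¹)) ?_
  filter_upwards [Ioc_mem_nhdsGT one_pos] with t ht
  have ht0 : 0 < t := ht.1
  rw [expProd, fprod, norm_mul, norm_prod]
  have h : ∏ j, ‖(1 - Complex.exp (-(ω j) * t))⁻¹‖ ≤ ∏ j, (1 + (ω j).re⁻¹) * t⁻¹ := by
    refine Finset.prod_le_prod (fun _ _ => norm_nonneg _) fun j _ =>
      (norm_inv_one_sub_exp_le (hω j) ht0).trans ?_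
    have := (one_le_inv₀ ht0).2 ht.2
    linarith
  rw [Finset.prod_mul_distrib, Finset.prod_const, Finset.card_univ, Fintype.card_fin] at h
  rw [Real.rpow_neg ht0.le, Real.rpow_natCast, Real.norm_of_nonneg (by positivity), ← inv_pow]
  calc _ ≤ (∏ j, ‖(1 - Complex.exp (-(ω j) * t))⁻¹‖) * 1 :=
        mul_le_mul_of_nonneg_left (norm_exp_neg_mul_lt_one hw ht0).le
          (Finset.prod_nonneg fun _ _ => norm_nonneg _)
    _ ≤ _ := by simpa using h

theorem mellinConvergent_expProd {r : ℕ} {ω : Fin r → ℂ} (hω : ∀ j, 0 < (ω j).re) {w : ℂ}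
    (hw : 0 < w.re) {s : ℂ} (hs : (r : ℝ) < s.re) : MellinConvergent (expProd r ω w) s :=
  mellinConvergent_of_isBigO_rpow_exp hw
    ((continuousOn_expProd hω w).locallyIntegrableOn measurableSet_Ioi)
    (expProd_isBigO_exp hω w) (expProd_isBigO_rpow hω hw) hs

theorem hasSum_exp_expProd {r : ℕ} {ω : Fin r → ℂ} (hω : ∀ j, 0 < (ω j).re) (w : ℂ)
    {t : ℝ} (ht : 0 < t) :
    HasSum (fun n : Fin r → ℕ => Complex.exp (-(∑ i, (n i : ℂ) * ω i + w) * t))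
      (expProd r ω w t) := by
  have h := (hasSum_pi_geometric r (fun j => Complex.exp (-(ω j) * t))
    fun j => norm_exp_neg_mul_lt_one (hω j) ht).1.mul_right (Complex.exp (-w * t))
  refine h.congr_fun fun n => ?_
  simp only [← Complex.exp_nat_mul, ← Complex.exp_sum, ← Complex.exp_add]
  congr 1
  rw [neg_add, add_mul, ← Finset.sum_neg_distrib, Finset.sum_mul]
  congr 1
  exact Finset.sum_congr rfl fun i _ => by ring

theorem hasSum_mellin_expProd {r : ℕ} {ω : Fin r → ℂ} (hω : ∀ j, 0 < (ω j).re) {w : ℂ}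
    (hw : 0 < w.re) {s : ℂ} (hs : (r : ℝ) < s.re) :
    HasSum (fun n : Fin r → ℕ => (∑ i, (n i : ℂ) * ω i + w) ^ (-s) * Complex.Gamma s)
      (mellin (expProd r ω w) s) := by
  have hs0 : 0 < s.re := lt_of_le_of_lt (Nat.cast_nonneg r) hs
  have hre : ∀ n : Fin r → ℕ, 0 < (∑ i, (n i : ℂ) * ω i + w).re := fun n => by
    have : 0 ≤ ∑ i, ((n i : ℂ) * ω i).re :=
      Finset.sum_nonneg fun i _ => by simpa using mul_nonneg (Nat.cast_nonneg (n i)) (hω i).le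
    rw [Complex.add_re, Complex.re_sum]
    linarith
  set ω' : Fin r → ℂ := fun j => ((ω j).re : ℂ) with hω'
  have hint := (mellinConvergent_expProd (ω := ω') (w := (w.re : ℂ))
    (fun j => by simpa [hω'] using hω j) (by simpa using hw) hs).norm
  have hbound : ∀ (u : Finset (Fin r → ℕ)) {t : ℝ}, 0 < t →
      ∑ n ∈ u, ‖(t : ℂ) ^ (s - 1) * Complex.exp (-(∑ i, (n i : ℂ) * ω i + w) * t)‖
        ≤ ‖(t : ℂ) ^ (s - 1) • expProd r ω' w.re t‖ := fun u t ht => by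
    have h := Complex.hasSum_re (hasSum_exp_expProd (ω := ω')
      (fun j => by simpa [hω'] using hω j) (w.re : ℂ) ht)
    have heq : ∀ n : Fin r → ℕ,
        (Complex.exp (-(∑ i, (n i : ℂ) * ω' i + (w.re : ℂ)) * t)).re =
          ‖Complex.exp (-(∑ i, (n i : ℂ) * ω i + w) * t)‖ := fun n => by
      have : -(∑ i, (n i : ℂ) * ω' i + (w.re : ℂ)) * t =
          (((-(∑ i, (n i : ℂ) * ω i + w) * t).re : ℝ) : ℂ) := by
        simp [hω', Complex.re_sum]
      rw [Complex.norm_exp, this, Complex.exp_ofReal_re]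
    simp only [heq] at h
    simp only [norm_mul, norm_smul, ← Finset.mul_sum]
    refine mul_le_mul_of_nonneg_left ?_ (norm_nonneg _)
    have hle := sum_le_hasSum u (fun _ _ => norm_nonneg _) h
    exact hle.trans (Complex.re_le_norm _)
  have hF := fun n : Fin r → ℕ => integrableOn_cpow_mul_exp_neg_mul hs0 (hre n)
  have hsum := hasSum_integral_of_summable_integral_norm hF
    (summable_of_sum_le (c := ∫ t in Ioi (0 : ℝ), ‖(t : ℂ) ^ (s - 1) • expProd r ω' w.re t‖)
      (fun n => integral_nonneg fun t => norm_nonneg _) fun u => by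
        rw [← integral_finsetSum _ fun n _ => (hF n).norm]
        exact setIntegral_mono_on (integrable_finsetSum _ fun n _ => (hF n).norm) hint
          measurableSet_Ioi fun t ht => hbound u ht)
  simp only [integral_cpow_mul_exp_neg_mul_complex hs0 (hre _)] at hsum
  have hm : mellin (expProd r ω w) s = ∫ t in Ioi (0 : ℝ), ∑' n : Fin r → ℕ,
      (t : ℂ) ^ (s - 1) * Complex.exp (-(∑ i, (n i : ℂ) * ω i + w) * t) :=
    setIntegral_congr_fun measurableSet_Ioi fun t ht =>
      ((hasSum_exp_expProd hω w ht).mul_left _).tsum_eq.symm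
  rw [hm]
  exact hsum

/-- `f` minus the first `N` terms of its expansion `∑ c k t^(k - r)` at `0`, the latter cut off
to `(0, 1]`. -/
noncomputable def mellinRemainder (f : ℝ → ℂ) (c : ℕ → ℂ) (r N : ℕ) (t : ℝ) : ℂ :=
  f t - ∑ k ∈ Finset.range N,
    c k • indicator (Ioc 0 1) (fun t : ℝ => (t : ℂ) ^ ((k : ℂ) - (r : ℂ))) t

theorem mellinRemainder_succ (f : ℝ → ℂ) (c : ℕ → ℂ) (r N : ℕ) :
    mellinRemainder f c r (N + 1) = fun t => mellinRemainder f c r N t -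
      c N • indicator (Ioc 0 1) (fun t : ℝ => (t : ℂ) ^ ((N : ℂ) - (r : ℂ))) t := by
  funext t
  simp only [mellinRemainder, Finset.sum_range_succ]
  ring

/-- The extension, holomorphic on `ℂ ∖ {1, …, r}`, of `s ↦ 1 / (Γ(s) (s + k - r))`. -/
noncomputable def poleTerm (r k : ℕ) (s : ℂ) : ℂ :=
  if k < r then (Complex.Gamma s)⁻¹ * (1 / (s + ((k : ℂ) - (r : ℂ))))
  else (∏ i ∈ Finset.range (k - r), (s + i)) * (Complex.Gamma (s + (k - r : ℕ) + 1))⁻¹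

theorem inv_Gamma_eq_prod_mul (s : ℂ) (m : ℕ) :
    (Complex.Gamma s)⁻¹ = (∏ i ∈ Finset.range m, (s + i)) * (Complex.Gamma (s + m))⁻¹ := by
  induction m with
  | zero => simp
  | succ m ih =>
    rw [ih, Finset.prod_range_succ, Complex.one_div_Gamma_eq_self_mul_one_div_Gamma_add_one (s + m)]
    push_cast
    rw [add_assoc s]
    ring

theorem poleTerm_eq {r k : ℕ} {s : ℂ} (h : s + ((k : ℂ) - (r : ℂ)) ≠ 0) :
    poleTerm r k s = (Complex.Gamma s)⁻¹ * (1 / (s + ((k : ℂ) - (r : ℂ)))) := by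
  unfold poleTerm
  split_ifs with hk
  · rfl
  · rw [not_lt] at hk
    rw [← Nat.cast_sub hk] at h ⊢
    rw [inv_Gamma_eq_prod_mul s (k - r + 1), Finset.prod_range_succ]
    push_cast [-Nat.cast_sub]
    rw [← add_assoc]
    field_simp

theorem differentiableAt_poleTerm {r k : ℕ} {s : ℂ}
    (hs : ∀ m : ℕ, 1 ≤ m → m ≤ r → s ≠ (m : ℂ)) : DifferentiableAt ℂ (poleTerm r k) s := by
  by_cases hk : k < r
  · have hne : s + ((k : ℂ) - (r : ℂ)) ≠ 0 := fun h => by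
      refine hs (r - k) (by omega) (by omega) ?_
      rw [Nat.cast_sub hk.le]
      linear_combination h
    have : poleTerm r k =
        fun s => (Complex.Gamma s)⁻¹ * (1 / (s + ((k : ℂ) - (r : ℂ)))) := by
      funext s
      simp [poleTerm, hk]
    rw [this]
    exact (Complex.differentiable_one_div_Gamma s).mul
      ((differentiableAt_const _).div (by fun_prop) hne)
  · have : poleTerm r k = fun s : ℂ => (∏ i ∈ Finset.range (k - r), (s + i)) *
        (Complex.Gamma (s + (k - r : ℕ) + 1))⁻¹ := by
      funext s
      simp only [poleTerm, hk, if_false]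
    rw [this]
    refine DifferentiableAt.mul (by fun_prop) ?_
    exact (Complex.differentiable_one_div_Gamma (s + (k - r : ℕ) + 1)).comp s
      (f := fun s : ℂ => s + (k - r : ℕ) + 1) (by fun_prop)

theorem poleTerm_neg_nat (r k n : ℕ) :
    poleTerm r k (-(n : ℂ)) = if k = n + r then (-1) ^ n * (n.factorial : ℂ) else 0 := by
  split_ifs with hk
  · subst hk
    have h1 : ∏ i ∈ Finset.range n, (-(n : ℂ) + i) = (-1) ^ n * (n.factorial : ℂ) := by
      rw [← Finset.prod_range_reflect, ← Finset.prod_range_add_one_eq_factorial]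
      push_cast
      rw [← Finset.card_range n, ← Finset.prod_const, Finset.card_range, ← Finset.prod_mul_distrib]
      refine Finset.prod_congr rfl fun i hi => ?_
      have : i + 1 ≤ n := Finset.mem_range.1 hi
      rw [Nat.sub_sub, add_comm 1 i, Nat.cast_sub this]
      push_cast
      ring
    simp [poleTerm, h1]
  · rw [poleTerm_eq, Complex.Gamma_neg_nat_eq_zero]
    · simp
    · intro h
      apply hk
      have : (k : ℂ) = ((n + r : ℕ) : ℂ) := by
        push_cast
        linear_combination h
      exact_mod_cast this

theorem locallyIntegrableOn_mellinRemainder {f : ℝ → ℂ} (hfc : ContinuousOn f (Ioi 0))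
    (c : ℕ → ℂ) (r N : ℕ) : LocallyIntegrableOn (mellinRemainder f c r N) (Ioi 0) := by
  induction N with
  | zero =>
    have hf : mellinRemainder f c r 0 = f := by
      funext t
      simp [mellinRemainder]
    rw [hf]
    exact hfc.locallyIntegrableOn measurableSet_Ioi
  | succ N ih =>
    rw [mellinRemainder_succ]
    have hpow : LocallyIntegrableOn (fun t : ℝ => (t : ℂ) ^ ((N : ℂ) - (r : ℂ))) (Ioi 0) :=
      ContinuousOn.locallyIntegrableOn
        (fun t ht => (Complex.continuousAt_ofReal_cpow_const _ _
          (Or.inr (ne_of_gt ht))).continuousWithinAt) measurableSet_Ioi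
    have hind : LocallyIntegrableOn
        (indicator (Ioc 0 1) fun t : ℝ => (t : ℂ) ^ ((N : ℂ) - (r : ℂ))) (Ioi 0) := fun x hx => by
      obtain ⟨u, hu, hi⟩ := hpow x hx
      exact ⟨u, hu, hi.indicator measurableSet_Ioc⟩
    exact ih.sub (hind.smul (c N))

theorem mellinRemainder_convergent_differentiableAt {f : ℝ → ℂ} {c : ℕ → ℂ} {r : ℕ} {a : ℝ}
    (ha : 0 < a) (hfc : ContinuousOn f (Ioi 0)) (htop : f =O[atTop] fun t => Real.exp (-a * t))
    {N : ℕ} (hzero : (fun t : ℝ => f t - ∑ k ∈ Finset.range N,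
      c k * (t : ℂ) ^ ((k : ℂ) - (r : ℂ))) =O[𝓝[>] 0] fun t => t ^ ((N : ℝ) - r))
    {s : ℂ} (hs : (r : ℝ) - N < s.re) :
    MellinConvergent (mellinRemainder f c r N) s ∧
      DifferentiableAt ℂ (mellin (mellinRemainder f c r N)) s := by
  have hloc := locallyIntegrableOn_mellinRemainder hfc c r N
  have htop' : mellinRemainder f c r N =O[atTop] fun t => Real.exp (-a * t) := by
    refine htop.congr' ?_ EventuallyEq.rfl
    filter_upwards [eventually_gt_atTop 1] with t ht
    simp [mellinRemainder, ht.not_ge]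
  have hzero' : mellinRemainder f c r N =O[𝓝[>] 0] fun t => t ^ (-((r : ℝ) - N)) := by
    refine hzero.congr' ?_ ?_
    · filter_upwards [Ioc_mem_nhdsGT (zero_lt_one' ℝ)] with t ht
      simp only [mellinRemainder, indicator_of_mem ht, smul_eq_mul]
    · rw [neg_sub]
  exact ⟨mellinConvergent_of_isBigO_rpow_exp ha hloc htop' hzero' hs,
    mellin_differentiableAt_of_isBigO_rpow_exp ha hloc htop' hzero' hs⟩

/-- The continuation of `mellin f s / Γ(s)` to `r - N < re s`. -/
noncomputable def mellinContinuationAux (f : ℝ → ℂ) (c : ℕ → ℂ) (r N : ℕ) (s : ℂ) : ℂ :=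
  (Complex.Gamma s)⁻¹ * mellin (mellinRemainder f c r N) s +
    ∑ k ∈ Finset.range N, c k * poleTerm r k s

theorem exists_mellin_continuation {f : ℝ → ℂ} {c : ℕ → ℂ} {r : ℕ} {a : ℝ}
    (ha : 0 < a) (hfc : ContinuousOn f (Ioi 0)) (htop : f =O[atTop] fun t => Real.exp (-a * t))
    (hzero : ∀ N : ℕ, (fun t : ℝ => f t - ∑ k ∈ Finset.range N,
      c k * (t : ℂ) ^ ((k : ℂ) - (r : ℂ))) =O[𝓝[>] 0] fun t => t ^ ((N : ℝ) - r)) :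
    ∃ F : ℂ → ℂ,
      DifferentiableOn ℂ F {s : ℂ | ∀ m : ℕ, 1 ≤ m → m ≤ r → s ≠ (m : ℂ)} ∧
      (∀ s : ℂ, (r : ℝ) < s.re → F s = (Complex.Gamma s)⁻¹ * mellin f s) ∧
      ∀ n : ℕ, F (-(n : ℂ)) = (-1) ^ n * (n.factorial : ℂ) * c (n + r) := by
  set G := mellinContinuationAux f c r with hG
  have hsucc : ∀ (N : ℕ) (s : ℂ), (r : ℝ) - N < s.re → G (N + 1) s = G N s := fun N s hs => by
    have hpos : 0 < s.re + ((N : ℂ) - (r : ℂ)).re := by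
      simp only [Complex.sub_re, Complex.natCast_re]
      linarith
    have hne : s + ((N : ℂ) - (r : ℂ)) ≠ 0 := fun h => by
      rw [← Complex.add_re, h] at hpos
      simp at hpos
    have hind := hasMellin_cpow_Ioc ((N : ℂ) - (r : ℂ)) hpos
    have hm := (hasMellin_sub
      (mellinRemainder_convergent_differentiableAt ha hfc htop (hzero N) hs).1
      (hind.1.const_smul (c N))).2
    rw [hG, mellinContinuationAux, mellinContinuationAux, mellinRemainder_succ, hm,
      mellin_const_smul, hind.2, Finset.sum_range_succ, poleTerm_eq hne, smul_eq_mul]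
    ring
  have hle : ∀ (N M : ℕ) (s : ℂ), N ≤ M → (r : ℝ) - N < s.re → G M s = G N s :=
    fun N M s hNM hs => by
      induction M, hNM using Nat.le_induction with
      | base => rfl
      | succ M hM ih =>
        have : (N : ℝ) ≤ M := by exact_mod_cast hM
        rw [hsucc M s (by linarith), ih]
  have heq : ∀ (N M : ℕ) (s : ℂ), (r : ℝ) - N < s.re → (r : ℝ) - M < s.re → G M s = G N s :=
    fun N M s hN hM => by
      rcases le_total N M with h | h
      · exact hle N M s h hN
      · exact (hle M N s h hM).symm
  have hfloor : ∀ s : ℂ, (r : ℝ) - (⌊(r : ℝ) - s.re⌋₊ + 1 : ℕ) < s.re := fun s => by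
    have := Nat.lt_floor_add_one ((r : ℝ) - s.re)
    push_cast
    linarith
  refine ⟨fun s => G (⌊(r : ℝ) - s.re⌋₊ + 1) s, fun s hs => ?_, fun s hs => ?_, fun n => ?_⟩
  · have hd : DifferentiableAt ℂ (G (⌊(r : ℝ) - s.re⌋₊ + 1)) s := by
      refine ((Complex.differentiable_one_div_Gamma s).mul
        (mellinRemainder_convergent_differentiableAt ha hfc htop (hzero _) (hfloor s)).2).add ?_
      exact DifferentiableAt.fun_sum fun k _ => (differentiableAt_poleTerm hs).const_mul _
    refine (hd.congr_of_eventuallyEq ?_).differentiableWithinAt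
    filter_upwards [(isOpen_lt continuous_const Complex.continuous_re).mem_nhds (hfloor s)]
      with z hz
    exact heq _ _ z hz (hfloor z)
  · have h0 : (r : ℝ) - (0 : ℕ) < s.re := by simpa using hs
    have hf : mellinRemainder f c r 0 = f := by
      funext t
      simp [mellinRemainder]
    simp only
    rw [heq 0 _ s h0 (hfloor s), hG, mellinContinuationAux, hf]
    simp
  · have hN : (r : ℝ) - (n + r + 1 : ℕ) < (-(n : ℂ)).re := by
      simp only [Complex.neg_re, Complex.natCast_re]
      push_cast
      linarith
    simp only
    rw [heq (n + r + 1) _ _ hN (hfloor _), hG, mellinContinuationAux,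
      Complex.Gamma_neg_nat_eq_zero]
    simp only [poleTerm_neg_nat]
    simp [mul_comm]

theorem expProd_expansion_isBigO {r : ℕ} {ω : Fin r → ℂ} {w : ℂ} {g : ℂ → ℂ}
    (hg : AnalyticAt ℂ g 0)
    (hgeq : ∀ᶠ t in 𝓝[≠] (0 : ℂ), g t = t ^ r * fprod r ω t * Complex.exp (-w * t)) (N : ℕ) :
    (fun t : ℝ => expProd r ω w t - ∑ k ∈ Finset.range N,
      (iteratedDeriv k g 0 / (k.factorial : ℂ)) * (t : ℂ) ^ ((k : ℂ) - (r : ℂ)))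
      =O[𝓝[>] 0] fun t => t ^ ((N : ℝ) - r) := by
  have hto : Tendsto (fun t : ℝ => (t : ℂ)) (𝓝[>] 0) (𝓝[≠] 0) := by
    refine tendsto_nhdsWithin_iff.2 ⟨?_, ?_⟩
    · exact (Complex.continuous_ofReal.tendsto' 0 0 (by simp)).mono_left nhdsWithin_le_nhds
    · filter_upwards [self_mem_nhdsWithin] with x hx
      simpa using (ne_of_gt hx : x ≠ 0)
  have hpow := hg.hasFPowerSeriesAt.isBigO_sub_partialSum_pow N
  simp only [← norm_pow, isBigO_norm_right] at hpow
  have hb := hpow.comp_tendsto (hto.mono_right nhdsWithin_le_nhds)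
  have hmul := (isBigO_refl (fun t : ℝ => (t : ℂ) ^ (-(r : ℂ))) (𝓝[>] 0)).mul hb
  refine (hmul.congr' ?_ EventuallyEq.rfl).trans (IsBigO.of_bound 1 ?_)
  · filter_upwards [hto.eventually hgeq, self_mem_nhdsWithin] with t ht ht0
    have htc : (t : ℂ) ≠ 0 := by simpa using (ne_of_gt ht0 : t ≠ 0)
    have hcancel : (t : ℂ) ^ (-(r : ℂ)) * (t : ℂ) ^ r = 1 := by
      rw [Complex.cpow_neg, Complex.cpow_natCast, inv_mul_cancel₀ (pow_ne_zero _ htc)]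
    simp only [Function.comp_apply, zero_add, ht, expProd, mul_sub,
      FormalMultilinearSeries.partialSum, Finset.mul_sum]
    congr 1
    · rw [← mul_assoc, ← mul_assoc, hcancel, one_mul]
    · refine Finset.sum_congr rfl fun k _ => ?_
      rw [FormalMultilinearSeries.ofScalars_apply_eq, sub_eq_add_neg,
        Complex.cpow_add _ _ htc, Complex.cpow_natCast, smul_eq_mul]
      ring
  · filter_upwards [self_mem_nhdsWithin] with t ht
    have ht0 : 0 < t := ht
    simp only [Function.comp_apply, norm_mul, norm_pow, Complex.norm_real, one_mul]
    rw [Complex.norm_cpow_eq_rpow_re_of_pos ht0, Real.norm_of_nonneg ht0.le,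
      Real.norm_of_nonneg (by positivity), sub_eq_add_neg, Real.rpow_add ht0, Real.rpow_natCast]
    simp [mul_comm]

theorem eqOn_of_eq_of_lt_re {r : ℕ} {F G : ℂ → ℂ}
    (hF : DifferentiableOn ℂ F {s : ℂ | ∀ m : ℕ, 1 ≤ m → m ≤ r → s ≠ (m : ℂ)})
    (hG : DifferentiableOn ℂ G {s : ℂ | ∀ m : ℕ, 1 ≤ m → m ≤ r → s ≠ (m : ℂ)})
    (h : ∀ s : ℂ, (r : ℝ) < s.re → F s = G s) :
    EqOn F G {s : ℂ | ∀ m : ℕ, 1 ≤ m → m ≤ r → s ≠ (m : ℂ)} := by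
  have hU : {s : ℂ | ∀ m : ℕ, 1 ≤ m → m ≤ r → s ≠ (m : ℂ)} =
      ((fun m : ℕ => (m : ℂ)) '' Icc 1 r)ᶜ := by
    ext s
    simp only [mem_ofPred_eq, mem_compl_iff, mem_image, mem_Icc, not_exists, not_and, and_imp]
    exact forall_congr' fun m => forall_congr' fun _ => forall_congr' fun _ => ne_comm
  have hfin : ((fun m : ℕ => (m : ℂ)) '' Icc 1 r).Finite := (finite_Icc 1 r).image _
  have hopen : IsOpen {s : ℂ | ∀ m : ℕ, 1 ≤ m → m ≤ r → s ≠ (m : ℂ)} :=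
    hU ▸ hfin.isClosed.isOpen_compl
  have hconn : IsPreconnected {s : ℂ | ∀ m : ℕ, 1 ≤ m → m ≤ r → s ≠ (m : ℂ)} :=
    hU ▸ (hfin.countable.isConnected_compl_of_one_lt_rank (by simp)).isPreconnected
  refine (hF.analyticOnNhd hopen).eqOn_of_preconnected_of_eventuallyEq (hG.analyticOnNhd hopen)
    hconn (z₀ := ((r + 1 : ℕ) : ℂ)) (fun m _ hm hne => ?_) ?_
  · have : r + 1 = m := by exact_mod_cast hne
    omega
  · filter_upwards [(isOpen_lt continuous_const Complex.continuous_re).mem_nhds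
      (show (r : ℝ) < ((r + 1 : ℕ) : ℂ).re by rw [Complex.natCast_re]; push_cast; linarith)]
      with s hs
    exact h s hs

/-- (i) The multiple Hurwitz zeta function `ζ_r(s,w;ω)` has an analytic
continuation `F` holomorphic on `ℂ ∖ {1,…,r}`; (ii) every such continuation satisfies
`F(-n) = (-1)^n n! a_{r,n}(w;ω)` for every integer `n ≥ 0`. -/
theorem multiple_hurwitz_zeta_continuation_special_values (r : ℕ) (ω : Fin r → ℂ)
    (hω : ∀ j, 0 < (ω j).re) (w : ℂ) (hw : 0 < w.re)
    (a : ℤ → ℂ) (ha : IsMBernoulli r ω w a) :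
    (∃ F : ℂ → ℂ,
      DifferentiableOn ℂ F {s : ℂ | ∀ m : ℕ, 1 ≤ m → m ≤ r → s ≠ (m : ℂ)} ∧
      ∀ s : ℂ, (r : ℝ) < s.re →
        F s = ∑' n : Fin r → ℕ, (∑ i, (n i : ℂ) * ω i + w) ^ (-s)) ∧
    (∀ F : ℂ → ℂ,
      DifferentiableOn ℂ F {s : ℂ | ∀ m : ℕ, 1 ≤ m → m ≤ r → s ≠ (m : ℂ)} →
      (∀ s : ℂ, (r : ℝ) < s.re →
        F s = ∑' n : Fin r → ℕ, (∑ i, (n i : ℂ) * ω i + w) ^ (-s)) →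
      ∀ n : ℕ, F (-(n : ℂ)) = (-1) ^ n * (n.factorial : ℂ) * a (n : ℤ)) := by
  obtain ⟨-, g, hg, hgeq, hag⟩ := ha
  obtain ⟨G, hGd, hGs, hGn⟩ := exists_mellin_continuation hw (continuousOn_expProd hω w)
    (expProd_isBigO_exp hω w) (expProd_expansion_isBigO hg hgeq)
  have hseries : ∀ s : ℂ, (r : ℝ) < s.re →
      G s = ∑' n : Fin r → ℕ, (∑ i, (n i : ℂ) * ω i + w) ^ (-s) := fun s hs => by
    have hs0 : 0 < s.re := lt_of_le_of_lt (Nat.cast_nonneg r) hs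
    rw [hGs s hs, ← (hasSum_mellin_expProd hω hw hs).tsum_eq, tsum_mul_right, mul_comm,
      mul_assoc, mul_inv_cancel₀ (Complex.Gamma_ne_zero_of_re_pos hs0), mul_one]
  refine ⟨⟨G, hGd, hseries⟩, fun F hFd hFs n => ?_⟩
  have hmem : (-(n : ℂ)) ∈ {s : ℂ | ∀ m : ℕ, 1 ≤ m → m ≤ r → s ≠ (m : ℂ)} :=
    fun m hm _ h => by
      have h0 : ((m + n : ℕ) : ℂ) = 0 := by
        push_cast
        linear_combination -h
      have : m + n = 0 := by exact_mod_cast h0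
      omega
  rw [eqOn_of_eq_of_lt_re hFd hGd (fun s hs => (hFs s hs).trans (hseries s hs).symm) hmem, hGn,
    hag n (by omega)]
  rw [show ((n : ℤ) + r).toNat = n + r by omega]
end

section
/- For every integer k ≥ 0, the function s ↦ Γ′(s)/Γ(s) + 2πi·e^{2πis}/(e^{2πis} − 1) (of a complex variable s, defined on a punctured neighborhood of −k) tends to H_k + πi − γ as s → −k with s ≠ −k, where Γ is the complex Gamma function, Γ′ its derivative, H_k = ∑_{j=1}^k 1/j (H_0 = 0), and γ is the Euler–Mascheroni constant. -/
open Filter Topology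

theorem tendsto_exp_sub_one_div :
    Tendsto (fun z : ℂ => (Complex.exp z - 1) / z) (𝓝[≠] 0) (𝓝 1) := by
  have h := (Complex.hasDerivAt_exp 0).tendsto_slope_zero
  simpa [div_eq_inv_mul] using h

theorem tendsto_exp_sub_one_sub_id_div_sq :
    Tendsto (fun z : ℂ => (Complex.exp z - 1 - z) / z ^ 2) (𝓝[≠] 0) (𝓝 (1 / 2)) := by
  have h := (Complex.exp_sub_sum_range_succ_isLittleO_pow 2).tendsto_div_nhds_zero
  have h' := (h.mono_left (nhdsWithin_le_nhds (s := {0}ᶜ))).add_const (1 / 2 : ℂ)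
  rw [zero_add] at h'
  refine h'.congr' ?_
  filter_upwards [self_mem_nhdsWithin] with z (hz : z ≠ 0)
  simp only [Finset.sum_range_succ, Finset.sum_range_zero, Nat.factorial]
  field_simp
  push_cast
  ring

theorem tendsto_exp_div_exp_sub_one_sub_inv :
    Tendsto (fun z : ℂ => Complex.exp z / (Complex.exp z - 1) - z⁻¹) (𝓝[≠] 0)
      (𝓝 (1 / 2)) := by
  have h := (tendsto_exp_sub_one_div.sub tendsto_exp_sub_one_sub_id_div_sq).div
    tendsto_exp_sub_one_div one_ne_zero
  norm_num at h
  norm_num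
  refine h.congr' ?_
  filter_upwards [self_mem_nhdsWithin, tendsto_exp_sub_one_div.eventually_ne one_ne_zero]
    with z (hz : z ≠ 0) hne
  have he : Complex.exp z - 1 ≠ 0 := fun h0 => hne (by simp [h0])
  simp only [Pi.div_apply]
  field_simp
  ring

theorem eventually_forall_ne_neg_natCast (k : ℕ) :
    ∀ᶠ s : ℂ in 𝓝[≠] (-(k : ℂ)), ∀ m : ℕ, s ≠ -m := by
  filter_upwards [self_mem_nhdsWithin, nhdsWithin_le_nhds (Metric.ball_mem_nhds _ one_pos)]
    with s (hs : s ≠ -k) hball m rfl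
  rw [Metric.mem_ball, dist_neg_neg, dist_eq_norm, ← Int.cast_natCast m, ← Int.cast_natCast k,
    ← Int.cast_sub, Complex.norm_intCast] at hball
  have habs : |(m : ℤ) - k| < 1 := by
    rw [← Int.cast_abs] at hball
    exact Int.cast_lt.mp (hball.trans_eq Int.cast_one.symm)
  rw [Int.abs_lt_one_iff, sub_eq_zero, Nat.cast_inj] at habs
  exact hs (by rw [habs])

theorem continuousAt_digamma_one : ContinuousAt Complex.digamma 1 := by
  have hd : DifferentiableOn ℂ Complex.Gamma {s | 0 < s.re} := fun s hs =>
    (Complex.differentiableAt_Gamma s fun m hm => by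
      have hre : 0 < s.re := hs
      simp only [hm, Complex.neg_re, Complex.natCast_re, Left.neg_pos_iff] at hre
      exact hre.not_ge m.cast_nonneg).differentiableWithinAt
  have ha : AnalyticAt ℂ Complex.Gamma 1 :=
    hd.analyticAt ((isOpen_lt continuous_const Complex.continuous_re).mem_nhds (by simp))
  exact ha.deriv.continuousAt.div ha.continuousAt (by simp)

theorem tendsto_digamma_add_inv_zero :
    Tendsto (fun s : ℂ => Complex.digamma s + s⁻¹) (𝓝[≠] 0)
      (𝓝 (-Real.eulerMascheroniConstant)) := by
  have h : Tendsto (fun s : ℂ => Complex.digamma (s + 1)) (𝓝 0)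
      (𝓝 (Complex.digamma 1)) :=
    continuousAt_digamma_one.tendsto.comp
      (by simpa using (continuous_add_const (1 : ℂ)).tendsto 0)
  rw [Complex.digamma_one] at h
  refine (h.mono_left nhdsWithin_le_nhds).congr' ?_
  have hne := eventually_forall_ne_neg_natCast 0
  rw [Nat.cast_zero, neg_zero] at hne
  filter_upwards [hne] with s hs using Complex.digamma_apply_add_one s hs

/-- For every integer `k ≥ 0`, the function
`s ↦ Γ′(s)/Γ(s) + 2πi·e^{2πis}/(e^{2πis} - 1)` tends to `H_k + πi - γ` as `s → -k`,
`s ≠ -k`. -/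
theorem digamma_plus_cot_tendsto (k : ℕ) :
    Filter.Tendsto
      (fun s : ℂ => deriv Complex.Gamma s / Complex.Gamma s +
        2 * (Real.pi : ℂ) * Complex.I * Complex.exp (2 * (Real.pi : ℂ) * Complex.I * s) /
          (Complex.exp (2 * (Real.pi : ℂ) * Complex.I * s) - 1))
      (nhdsWithin (-(k : ℂ)) {(-(k : ℂ))}ᶜ)
      (nhds ((∑ j ∈ Finset.range k, (1 : ℂ) / (j + 1)) + Real.pi * Complex.I -
        Real.eulerMascheroniConstant)) := by
  induction k with
  | zero =>
    rw [Nat.cast_zero, neg_zero]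
    have ha : 2 * (Real.pi : ℂ) * Complex.I ≠ 0 := Complex.two_pi_I_ne_zero
    have hscale : Tendsto (fun s : ℂ => 2 * (Real.pi : ℂ) * Complex.I * s) (𝓝[≠] 0)
        (𝓝[≠] 0) := by
      refine tendsto_nhdsWithin_iff.mpr ⟨?_, ?_⟩
      · simpa using ((continuous_const_mul (2 * (Real.pi : ℂ) * Complex.I)).tendsto 0).mono_left
          nhdsWithin_le_nhds
      · filter_upwards [self_mem_nhdsWithin] with s hs using mul_ne_zero ha hs
    have h := tendsto_digamma_add_inv_zero.add
      ((tendsto_exp_div_exp_sub_one_sub_inv.comp hscale).const_mul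
        (2 * (Real.pi : ℂ) * Complex.I))
    convert h.congr' ?_ using 2
    · simp only [Finset.range_zero, Finset.sum_empty]
      ring
    · filter_upwards with s
      rw [Complex.digamma_def, logDeriv_apply, Function.comp_apply, mul_sub, mul_inv,
        mul_inv_cancel_left₀ ha]
      ring
  | succ k ih =>
    have hshift : Tendsto (fun s : ℂ => s + 1) (𝓝[≠] (-((k + 1 : ℕ) : ℂ)))
        (𝓝[≠] (-(k : ℂ))) := by
      have hk : -((k + 1 : ℕ) : ℂ) + 1 = -k := by push_cast; ring
      refine tendsto_nhdsWithin_iff.mpr ⟨?_, ?_⟩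
      · rw [← hk]
        exact ((continuous_add_const (1 : ℂ)).tendsto _).mono_left nhdsWithin_le_nhds
      · filter_upwards [self_mem_nhdsWithin] with s hs
        rw [← hk]
        exact fun h => hs (add_right_cancel h)
    have hk0 : -((k + 1 : ℕ) : ℂ) ≠ 0 := neg_ne_zero.mpr (Nat.cast_ne_zero.mpr k.succ_ne_zero)
    have h := (ih.comp hshift).sub ((tendsto_inv₀ hk0).mono_left nhdsWithin_le_nhds)
    convert h.congr' ?_ using 2
    · rw [Finset.sum_range_succ, inv_neg]
      push_cast
      ring
    · filter_upwards [eventually_forall_ne_neg_natCast (k + 1)] with s hs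
      have hd := Complex.digamma_apply_add_one s hs
      rw [Complex.digamma_def, logDeriv_apply, logDeriv_apply] at hd
      rw [Function.comp_apply, hd, mul_add, mul_one, Complex.exp_add, Complex.exp_two_pi_mul_I,
        mul_one]
      ring
end

section
/- (Classical Stirling formula.) Let a ∈ ℝ. Then there exist constants C > 0 and w_0 > 0 such that for every real w ≥ w_0: | log Γ(w + a) − ( (w + a − 1/2)·log w − w + (1/2)·log(2π) ) | ≤ C/w, where Γ is the (real) Gamma function and log is the real natural logarithm (note Γ(w+a) > 0 for w large). -/
open Filter Topology

/-- The remainder `log Γ(x) - ((x - 1/2) log x - x + (1/2) log (2π))` in Stirling's formula. -/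
noncomputable def stirlingRemainder (x : ℝ) : ℝ :=
  Real.log (Real.Gamma x) -
    ((x - 1 / 2) * Real.log x - x + (1 / 2) * Real.log (2 * Real.pi))

theorem log_Gamma_add_one {x : ℝ} (hx : 0 < x) :
    Real.log (Real.Gamma (x + 1)) = Real.log (Real.Gamma x) + Real.log x := by
  rw [Real.Gamma_add_one hx.ne', Real.log_mul hx.ne' (Real.Gamma_pos_of_pos hx).ne', add_comm]

theorem stirlingRemainder_sub_succ {x : ℝ} (hx : 0 < x) :
    stirlingRemainder x - stirlingRemainder (x + 1) =
      (x + 1 / 2) * Real.log (1 + x⁻¹) - 1 := by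
  have h : 1 + x⁻¹ = (x + 1) / x := by field
  rw [h, Real.log_div (by positivity) hx.ne', stirlingRemainder, stirlingRemainder,
    log_Gamma_add_one hx]
  ring

theorem hasSum_stirlingRemainder_sub_succ {x : ℝ} (hx : 0 < x) :
    HasSum (fun k : ℕ => 1 / (2 * ((k + 1 : ℕ) : ℝ) + 1) * ((1 / (2 * x + 1)) ^ 2) ^ (k + 1))
      (stirlingRemainder x - stirlingRemainder (x + 1)) := by
  let f (k : ℕ) := (1 : ℝ) / (2 * k + 1) * ((1 / (2 * x + 1)) ^ 2) ^ k
  change HasSum (fun k => f (k + 1)) _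
  rw [hasSum_nat_add_iff]
  convert! (Real.hasSum_log_one_add_inv hx).mul_left (x + 1 / 2) using 1
  · ext k
    dsimp only [f]
    rw [← pow_mul, pow_add]
    field
  · rw [stirlingRemainder_sub_succ hx]
    simp [f]

theorem stirlingRemainder_succ_le {x : ℝ} (hx : 0 < x) :
    stirlingRemainder (x + 1) ≤ stirlingRemainder x :=
  sub_nonneg.1 <| (hasSum_stirlingRemainder_sub_succ hx).nonneg fun k => by positivity

theorem stirlingRemainder_sub_succ_le {x : ℝ} (hx : 0 < x) :
    stirlingRemainder x - stirlingRemainder (x + 1) ≤ 1 / (12 * x) - 1 / (12 * (x + 1)) := by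
  have hq : (1 / (2 * x + 1)) ^ 2 < 1 := by
    rw [div_pow, one_pow, div_lt_one (by positivity)]
    nlinarith
  have hgeom := (hasSum_geometric_of_lt_one (by positivity) hq).mul_left
    ((1 / 3) * (1 / (2 * x + 1)) ^ 2)
  refine (hasSum_le (fun k => ?_) (hasSum_stirlingRemainder_sub_succ hx) hgeom).trans_eq ?_
  · rw [pow_succ', ← mul_assoc]
    gcongr
    push_cast
    linarith [(Nat.cast_nonneg k : (0 : ℝ) ≤ k)]
  · have h : 1 - (1 / (2 * x + 1)) ^ 2 = 4 * x * (x + 1) / (2 * x + 1) ^ 2 := by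
      field_simp
      ring
    rw [h]
    field_simp
    ring

theorem tendsto_stirlingRemainder_add_nat {x : ℝ} (hx : 0 < x) :
    Tendsto (fun n : ℕ => stirlingRemainder (x + n)) atTop (𝓝 0) := by
  rw [← tendsto_add_atTop_iff_nat 1]
  have hGamma := Real.BohrMollerup.tendsto_log_gamma hx
  have hfact := Stirling.tendsto_stirlingSeq_sqrt_pi.log (by positivity)
  have hmul := (Real.tendsto_mul_log_one_add_div_atTop (x + 1)).comp
    (tendsto_natCast_atTop_atTop (R := ℝ))
  have hlog : Tendsto (fun n : ℕ => Real.log (1 + (x + 1) / n)) atTop (𝓝 0) := by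
    have h := (tendsto_const_div_atTop_nhds_zero_nat (x + 1)).const_add 1
    simpa using h.log (by simp)
  have hlim := ((((hGamma.const_sub (Real.log (Real.Gamma x))).add
    (hfact.add_const (1 / 2 * Real.log 2 - 1 / 2 * Real.log (2 * Real.pi)))).sub hmul).sub
    (hlog.const_mul (x + 1 / 2))).add_const (x + 1)
  have hzero : Real.log (Real.Gamma x) - Real.log (Real.Gamma x) +
      (Real.log √Real.pi + (1 / 2 * Real.log 2 - 1 / 2 * Real.log (2 * Real.pi))) - (x + 1) -
      (x + 1 / 2) * 0 + (x + 1) = 0 := by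
    rw [Real.log_sqrt Real.pi_pos.le, Real.log_mul two_ne_zero Real.pi_ne_zero]
    ring
  rw [hzero] at hlim
  refine hlim.congr' ?_
  filter_upwards [eventually_gt_atTop 0] with n hn
  have hn' : (0 : ℝ) < n := Nat.cast_pos.2 hn
  have hsum := Real.BohrMollerup.f_add_nat_eq (f := fun y => Real.log (Real.Gamma y))
    log_Gamma_add_one hx (n + 1)
  have hquot : 1 + (x + 1) / n = (x + ((n + 1 : ℕ) : ℝ)) / n := by
    push_cast
    field
  simp only [Function.comp_apply, stirlingRemainder, hsum, Real.BohrMollerup.logGammaSeq,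
    Stirling.log_stirlingSeq_formula, hquot]
  rw [Real.log_div (by positivity) hn'.ne', Real.log_mul two_ne_zero hn'.ne',
    Real.log_div hn'.ne' (Real.exp_ne_zero 1), Real.log_exp]
  push_cast
  ring

theorem stirlingRemainder_nonneg {x : ℝ} (hx : 0 < x) : 0 ≤ stirlingRemainder x := by
  have hanti : Antitone fun n : ℕ => stirlingRemainder (x + n) :=
    antitone_nat_of_succ_le fun n => by
      simpa [add_assoc] using stirlingRemainder_succ_le (x := x + n) (by positivity)
  simpa using hanti.le_of_tendsto (tendsto_stirlingRemainder_add_nat hx) 0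

theorem stirlingRemainder_le {x : ℝ} (hx : 0 < x) : stirlingRemainder x ≤ 1 / (12 * x) := by
  have hmono : Monotone fun n : ℕ => stirlingRemainder (x + n) - 1 / (12 * (x + n)) :=
    monotone_nat_of_le_succ fun n => by
      have h := stirlingRemainder_sub_succ_le (x := x + n) (by positivity)
      rw [Nat.cast_succ, ← add_assoc]
      linarith
  have hinv : Tendsto (fun n : ℕ => 1 / (12 * (x + n))) atTop (𝓝 0) :=
    tendsto_const_nhds.div_atTop <| (tendsto_atTop_add_const_left _ x
      tendsto_natCast_atTop_atTop).const_mul_atTop (by norm_num)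
  have h := hmono.ge_of_tendsto ((tendsto_stirlingRemainder_add_nat hx).sub hinv) 0
  simp only [Nat.cast_zero, add_zero, sub_zero] at h
  linarith

theorem abs_log_one_add_div_sub_le {a w : ℝ} (hw : 0 < w) (haw : 2 * |a| ≤ w) :
    |w * Real.log (1 + a / w) - a| ≤ 2 * a ^ 2 / w := by
  have hwa : w / 2 ≤ w + a := by linarith [neg_abs_le a]
  have hpos : 0 < w + a := by linarith
  have h : 1 + a / w = (w + a) / w := by field
  have hupper : w * Real.log (1 + a / w) ≤ a := by
    have := mul_le_mul_of_nonneg_left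
      (Real.log_le_sub_one_of_pos (x := 1 + a / w) (by rw [h]; positivity)) hw.le
    calc _ ≤ _ := this
      _ = a := by field
  have hlower : a - a ^ 2 / (w + a) ≤ w * Real.log (1 + a / w) := by
    have := mul_le_mul_of_nonneg_left
      (Real.one_sub_inv_le_log_of_pos (x := 1 + a / w) (by rw [h]; positivity)) hw.le
    refine le_of_eq_of_le ?_ this
    rw [h]
    field_simp
    ring
  have hdiv : a ^ 2 / (w + a) ≤ 2 * a ^ 2 / w := by
    rw [div_le_div_iff₀ hpos hw]
    nlinarith [sq_nonneg a]
  rw [abs_le]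
  constructor <;> linarith [show 0 ≤ 2 * a ^ 2 / w by positivity]

/-- **Classical Stirling formula.** For every `a ∈ ℝ` there are
`C > 0`, `w₀ > 0` such that for all real `w ≥ w₀`,
`|log Γ(w+a) - ((w+a-1/2) log w - w + (1/2) log(2π))| ≤ C/w`. -/
theorem classical_stirling (a : ℝ) :
    ∃ C > (0 : ℝ), ∃ w₀ > (0 : ℝ), ∀ w : ℝ, w₀ ≤ w →
      |Real.log (Real.Gamma (w + a)) -
        ((w + a - 1 / 2) * Real.log w - w + (1 / 2) * Real.log (2 * Real.pi))| ≤ C / w := by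
  refine ⟨1 / 6 + 2 * a ^ 2 + |a - 1 / 2| * (2 * |a|), by positivity, 2 * |a| + 1,
    by positivity, fun w hw => ?_⟩
  have hw0 : 0 < w := by linarith [abs_nonneg a]
  have hwa : w / 2 ≤ w + a := by linarith [neg_abs_le a]
  have hpos : 0 < w + a := by linarith
  have hmain := abs_log_one_add_div_sub_le hw0 (a := a) (by linarith)
  have hlog : |Real.log (1 + a / w)| ≤ 2 * |a| / w := by
    have hsq : 2 * a ^ 2 / w ≤ |a| := by
      rw [div_le_iff₀ hw0, ← sq_abs]
      nlinarith [abs_nonneg a]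
    have habs : |w * Real.log (1 + a / w)| = |Real.log (1 + a / w)| * w := by
      rw [abs_mul, abs_of_pos hw0, mul_comm]
    rw [le_div_iff₀ hw0, ← habs]
    linarith [abs_sub_abs_le_abs_sub (w * Real.log (1 + a / w)) a]
  have hrem : |stirlingRemainder (w + a)| ≤ 1 / 6 / w := by
    rw [abs_of_nonneg (stirlingRemainder_nonneg hpos)]
    refine (stirlingRemainder_le hpos).trans ?_
    rw [div_div, div_le_div_iff₀ (by positivity) (by positivity)]
    linarith
  have hsplit : Real.log (Real.Gamma (w + a)) -
      ((w + a - 1 / 2) * Real.log w - w + (1 / 2) * Real.log (2 * Real.pi)) =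
      stirlingRemainder (w + a) + (w * Real.log (1 + a / w) - a) +
        (a - 1 / 2) * Real.log (1 + a / w) := by
    have h : 1 + a / w = (w + a) / w := by field
    rw [h, Real.log_div hpos.ne' hw0.ne', stirlingRemainder]
    ring
  rw [hsplit, add_div, add_div, mul_div_assoc |a - 1 / 2|]
  refine (abs_add_three _ _ _).trans ?_
  rw [abs_mul (a - 1 / 2)]
  gcongr
end
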